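/- Let n > 0. No sound and Σₙ-definable extension of Robinson arithmetic Q is Πₙ-complete: if T ⊇ Q is a theory whose set of (Gödel numbers of) axioms is definable in ℕ by a Σₙ-formula and every theorem of T is true in ℕ, then there exists a Πₙ-sentence true in ℕ that T does not prove. Moreover, the Gödel-style fixed point γ with Q ⊢ γ ↔ ¬Prov_T(⌜γ⌝) is such a sentence. -/

import Mathlib

/-!
Formalization of results from "Gödel–Rosser's Incompleteness Theorems for
non-RE Theories" (Salehi & Seraji).

We work in the first-order language of arithmetic `{0, S, +, ×, ≤}` with the
standard model `ℕ`.  Provability `T ⊢ φ` is rendered as the semantic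
consequence `T ⊨ᵇ φ` of Mathlib's model theory library, which by the Gödel
completeness theorem coincides with provability in first-order logic.
-/

open FirstOrder Language BoundedFormula

namespace GRNonRE

/-- Function symbols of arithmetic: `0`, `S`, `+`, `×`. -/
inductive ArithFunc : ℕ → Type
  | zero : ArithFunc 0
  | succ : ArithFunc 1
  | add  : ArithFunc 2
  | mul  : ArithFunc 2

/-- The relation symbol `≤`. -/
inductive ArithRel : ℕ → Type
  | le : ArithRel 2

/-- The first-order language of arithmetic `{0, S, +, ×, ≤}`. -/
def LA : FirstOrder.Language := ⟨ArithFunc, ArithRel⟩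

/-- The standard model `ℕ`. -/
instance : LA.Structure ℕ where
  funMap {_} f := match f with
    | ArithFunc.zero => fun _ => 0
    | ArithFunc.succ => fun v => v 0 + 1
    | ArithFunc.add  => fun v => v 0 + v 1
    | ArithFunc.mul  => fun v => v 0 * v 1
  RelMap {_} r := match r with
    | ArithRel.le => fun v => v 0 ≤ v 1

def zeroT {α : Type} : LA.Term α := Term.func ArithFunc.zero ![]
def succT {α : Type} (t : LA.Term α) : LA.Term α := Term.func ArithFunc.succ ![t]
def addT {α : Type} (t s : LA.Term α) : LA.Term α := Term.func ArithFunc.add ![t, s]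
def mulT {α : Type} (t s : LA.Term α) : LA.Term α := Term.func ArithFunc.mul ![t, s]

/-- The atomic formula `t ≤ s`. -/
def leF {α : Type} {n : ℕ} (t s : LA.Term (α ⊕ Fin n)) : LA.BoundedFormula α n :=
  BoundedFormula.rel ArithRel.le ![t, s]

/-- The numeral `m̄ = S (S ⋯ (S 0))` representing `m : ℕ`. -/
def numeral : ℕ → LA.Term Empty
  | 0 => zeroT
  | n + 1 => succT (numeral n)

instance : Encodable (Σ n, LA.Functions n) :=
  ⟨fun f => match f with
    | ⟨_, ArithFunc.zero⟩ => 0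
    | ⟨_, ArithFunc.succ⟩ => 1
    | ⟨_, ArithFunc.add⟩ => 2
    | ⟨_, ArithFunc.mul⟩ => 3,
   fun n => match n with
    | 0 => some ⟨0, ArithFunc.zero⟩
    | 1 => some ⟨1, ArithFunc.succ⟩
    | 2 => some ⟨2, ArithFunc.add⟩
    | 3 => some ⟨2, ArithFunc.mul⟩
    | _ => none,
   by rintro ⟨n, f⟩; cases f <;> rfl⟩

instance : Encodable (Σ n, LA.Relations n) :=
  ⟨fun _ => 0,
   fun n => match n with
    | 0 => some ⟨2, ArithRel.le⟩
    | _ => none,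
   by rintro ⟨n, r⟩; cases r; rfl⟩

/-- A standard Gödel numbering of formulas, obtained from Mathlib's structural
encoding of bounded formulas as lists of symbols. -/
def godel {k : ℕ} (φ : LA.BoundedFormula Empty k) : ℕ :=
  Encodable.encode φ.listEncode

/-- Lift a term in context `k` to context `k + 1`. -/
def liftT {k : ℕ} (t : LA.Term (Empty ⊕ Fin k)) : LA.Term (Empty ⊕ Fin (k + 1)) :=
  t.relabel (Sum.map id Fin.castSucc)

/-- The class `Σ₀ = Π₀ = Δ₀` of bounded formulas: built from atomic formulas by
Boolean connectives (`⊥` and `⟹`, from which `∼`, `⊓`, `⊔` are definable) and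
bounded universal quantification `∀ x ≤ t, φ` (bounded existential
quantification `∃ x ≤ t, φ` is expressible as `∼ ∀ x ≤ t, ∼φ`). -/
inductive Delta0 : ∀ {k : ℕ}, LA.BoundedFormula Empty k → Prop
  | falsum {k : ℕ} : Delta0 (⊥ : LA.BoundedFormula Empty k)
  | equal {k : ℕ} (t₁ t₂ : LA.Term (Empty ⊕ Fin k)) : Delta0 (t₁ =' t₂)
  | le {k : ℕ} (t₁ t₂ : LA.Term (Empty ⊕ Fin k)) : Delta0 (leF t₁ t₂)
  | imp {k : ℕ} {φ ψ : LA.BoundedFormula Empty k} :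
      Delta0 φ → Delta0 ψ → Delta0 (φ ⟹ ψ)
  | bdall {k : ℕ} (t : LA.Term (Empty ⊕ Fin k)) {φ : LA.BoundedFormula Empty (k + 1)} :
      Delta0 φ → Delta0 ((leF (&(Fin.last k)) (liftT t) ⟹ φ).all)

mutual
  /-- The classes `Σₙ` of the arithmetical hierarchy: `Σ₀` is the class of
  bounded formulas, and `Σ_{n+1}` contains `Πₙ` and is closed under `⊓`, `⊔`,
  existential quantification and bounded universal quantification. -/
  inductive IsSigma : ℕ → ∀ {k : ℕ}, LA.BoundedFormula Empty k → Prop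
    | ofDelta0 {k : ℕ} {φ : LA.BoundedFormula Empty k} : Delta0 φ → IsSigma 0 φ
    | ofPi {n k : ℕ} {φ : LA.BoundedFormula Empty k} :
        IsPi n φ → IsSigma (n + 1) φ
    | ex {n k : ℕ} {φ : LA.BoundedFormula Empty (k + 1)} :
        IsSigma (n + 1) φ → IsSigma (n + 1) φ.ex
    | inf {n k : ℕ} {φ ψ : LA.BoundedFormula Empty k} :
        IsSigma (n + 1) φ → IsSigma (n + 1) ψ → IsSigma (n + 1) (φ ⊓ ψ)
    | sup {n k : ℕ} {φ ψ : LA.BoundedFormula Empty k} :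
        IsSigma (n + 1) φ → IsSigma (n + 1) ψ → IsSigma (n + 1) (φ ⊔ ψ)
    | bdall {n k : ℕ} (t : LA.Term (Empty ⊕ Fin k))
        {φ : LA.BoundedFormula Empty (k + 1)} :
        IsSigma (n + 1) φ → IsSigma (n + 1) ((leF (&(Fin.last k)) (liftT t) ⟹ φ).all)

  /-- The classes `Πₙ` of the arithmetical hierarchy: `Π₀` is the class of
  bounded formulas, and `Π_{n+1}` contains `Σₙ` and is closed under `⊓`, `⊔`,
  universal quantification and bounded existential quantification. -/
  inductive IsPi : ℕ → ∀ {k : ℕ}, LA.BoundedFormula Empty k → Prop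
    | ofDelta0 {k : ℕ} {φ : LA.BoundedFormula Empty k} : Delta0 φ → IsPi 0 φ
    | ofSigma {n k : ℕ} {φ : LA.BoundedFormula Empty k} :
        IsSigma n φ → IsPi (n + 1) φ
    | all {n k : ℕ} {φ : LA.BoundedFormula Empty (k + 1)} :
        IsPi (n + 1) φ → IsPi (n + 1) φ.all
    | inf {n k : ℕ} {φ ψ : LA.BoundedFormula Empty k} :
        IsPi (n + 1) φ → IsPi (n + 1) ψ → IsPi (n + 1) (φ ⊓ ψ)
    | sup {n k : ℕ} {φ ψ : LA.BoundedFormula Empty k} :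
        IsPi (n + 1) φ → IsPi (n + 1) ψ → IsPi (n + 1) (φ ⊔ ψ)
    | bdex {n k : ℕ} (t : LA.Term (Empty ⊕ Fin k))
        {φ : LA.BoundedFormula Empty (k + 1)} :
        IsPi (n + 1) φ → IsPi (n + 1) ((leF (&(Fin.last k)) (liftT t) ⊓ φ).ex)
end

/-- `T ⊢ φ`: by the Gödel completeness theorem, provability of the sentence `φ`
from the theory `T` coincides with the semantic consequence relation. -/
def Proves (T : LA.Theory) (φ : LA.Sentence) : Prop := T ⊨ᵇ φ

/-- Consistency of a theory. -/
def Consistent (T : LA.Theory) : Prop := ¬ Proves T ⊥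

/-- `ψ(m̄)`: the result of substituting the numeral `m̄` for the free variable
of a formula `ψ(x)` with one free variable. -/
def subst1 (ψ : LA.BoundedFormula Empty 1) (m : ℕ) : LA.Sentence :=
  ψ.toFormula.subst fun _ => numeral m

/-- `n`-consistency: there is no formula `ψ(x) ∈ Π_{n-1}` such that `T ⊢ ¬ψ(m̄)`
for every numeral `m̄` (`m ∈ ℕ`) and yet `T ⊢ ∃x ψ(x)`.
(`0`-consistency is ordinary consistency.) -/
def NCon : ℕ → LA.Theory → Prop
  | 0, T => Consistent T
  | n + 1, T => ¬ ∃ ψ : LA.BoundedFormula Empty 1, IsPi n ψ ∧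
      (∀ m : ℕ, Proves T (∼(subst1 ψ m))) ∧ Proves T ψ.ex

/-- The axioms of Robinson arithmetic `Q`:
`Sx ≠ 0`, `Sx = Sy → x = y`, `x ≠ 0 → ∃y x = Sy`, `x + 0 = x`,
`x + Sy = S(x + y)`, `x·0 = 0`, `x·Sy = x·y + x`, `x ≤ y ↔ ∃z z + x = y`. -/
def QTheory : LA.Theory :=
  { ∀' ∼(succT (&0) =' zeroT),
    ∀' ∀' ((succT (&0) =' succT (&1)) ⟹ (&0 =' &1)),
    ∀' (∼(&0 =' zeroT) ⟹ ∃' (&0 =' succT (&1))),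
    ∀' (addT (&0) zeroT =' &0),
    ∀' ∀' (addT (&0) (succT (&1)) =' succT (addT (&0) (&1))),
    ∀' (mulT (&0) zeroT =' zeroT),
    ∀' ∀' (mulT (&0) (succT (&1)) =' addT (mulT (&0) (&1)) (&0)),
    ((leF (&0) (&1) ⇔ ∃' (addT (&2) (&0) =' (&1)) : LA.BoundedFormula Empty 2)).alls }

/-- `T` is an extension of Robinson arithmetic `Q` (i.e. `T` proves `Q`). -/
def ExtendsQ (T : LA.Theory) : Prop := ∀ φ ∈ QTheory, Proves T φ

/-- `Πₙ-Th(ℕ)`: the set of `Πₙ`-sentences true in the standard model. -/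
def PiTh (n : ℕ) : LA.Theory := {φ | IsPi n φ ∧ ℕ ⊨ φ}

/-- Soundness: every theorem of `T` is true in `ℕ`. -/
def Sound (T : LA.Theory) : Prop := ∀ φ : LA.Sentence, Proves T φ → ℕ ⊨ φ

/-- `Σₙ`-soundness: every `Σₙ`-sentence provable in `T` is true in `ℕ`. -/
def SigmaSound (n : ℕ) (T : LA.Theory) : Prop :=
  ∀ φ : LA.Sentence, IsSigma n φ → Proves T φ → ℕ ⊨ φ

/-- A formula `Ψ(x)` with one free variable defines the set `A ⊆ ℕ` in `ℕ`. -/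
def Defines (Ψ : LA.BoundedFormula Empty 1) (A : Set ℕ) : Prop :=
  ∀ m : ℕ, m ∈ A ↔ Ψ.Realize (fun e => Empty.elim e) ![m]

/-- `A ⊆ ℕ` is definable in `ℕ` by a `Σₙ`-formula. -/
def SigmaDefinable (n : ℕ) (A : Set ℕ) : Prop := ∃ Ψ, IsSigma n Ψ ∧ Defines Ψ A

/-- `A ⊆ ℕ` is definable in `ℕ` by a `Πₙ`-formula. -/
def PiDefinable (n : ℕ) (A : Set ℕ) : Prop := ∃ Ψ, IsPi n Ψ ∧ Defines Ψ A

/-- The set of Gödel numbers of the axioms of `T`. -/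
def axiomCodes (T : LA.Theory) : Set ℕ := {m | ∃ φ ∈ T, godel φ = m}

/-- The set of Gödel numbers of the theorems of `T` (its deductive closure). -/
def theoremCodes (T : LA.Theory) : Set ℕ := {m | ∃ φ, Proves T φ ∧ godel φ = m}

/-! ### Closure properties of the classes of the arithmetical hierarchy -/

section Semantics
variable {α : Type} (v : α → ℕ)

@[simp] theorem realize_zeroT : (zeroT : LA.Term α).realize v = 0 := rfl

@[simp] theorem realize_succT (t : LA.Term α) : (succT t).realize v = t.realize v + 1 := rfl

@[simp] theorem realize_addT (t s : LA.Term α) :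
    (addT t s).realize v = t.realize v + s.realize v := rfl

@[simp] theorem realize_mulT (t s : LA.Term α) :
    (mulT t s).realize v = t.realize v * s.realize v := rfl

@[simp] theorem realize_leF {n : ℕ} (t s : LA.Term (α ⊕ Fin n)) (xs : Fin n → ℕ) :
    (leF t s).Realize v xs ↔ t.realize (Sum.elim v xs) ≤ s.realize (Sum.elim v xs) := Iff.rfl

end Semantics

theorem Delta0.isSigma_and_isPi {k : ℕ} {φ : LA.BoundedFormula Empty k} (h : Delta0 φ) (n : ℕ) :
    IsSigma n φ ∧ IsPi n φ := by
  induction n with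
  | zero => exact ⟨.ofDelta0 h, .ofDelta0 h⟩
  | succ n ih => exact ⟨.ofPi ih.2, .ofSigma ih.1⟩

/-- Weakening a term along a renaming of its variables. -/
def renT {k m : ℕ} (σ : Fin k → Fin m) (t : LA.Term (Empty ⊕ Fin k)) : LA.Term (Empty ⊕ Fin m) :=
  t.relabel (Sum.map id σ)

theorem realize_renT {k m : ℕ} (σ : Fin k → Fin m) (t : LA.Term (Empty ⊕ Fin k))
    (w : Empty → ℕ) (v : Fin m → ℕ) :
    (renT σ t).realize (Sum.elim w v) = t.realize (Sum.elim w (v ∘ σ)) := by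
  rw [renT, Term.realize_relabel]
  congr 1
  ext (x | x) <;> rfl

theorem realize_liftT {M : Type} [LA.Structure M] {k : ℕ} (t : LA.Term (Empty ⊕ Fin k))
    (w : Empty → M) (v : Fin k → M) (x : M) :
    (liftT t).realize (Sum.elim w (Fin.snoc v x : Fin (k + 1) → M)) =
      t.realize (Sum.elim w v) := by
  rw [liftT, Term.realize_relabel]
  congr 1
  ext (y | y)
  · rfl
  · simp

theorem realize_bdall {k : ℕ} (t : LA.Term (Empty ⊕ Fin k)) (φ : LA.BoundedFormula Empty (k + 1))
    (w : Empty → ℕ) (v : Fin k → ℕ) :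
    ((leF (&(Fin.last k)) (liftT t) ⟹ φ).all).Realize w v ↔
      ∀ x ≤ t.realize (Sum.elim w v), φ.Realize w (Fin.snoc v x) := by
  simp [realize_liftT]

theorem realize_bdex {k : ℕ} (t : LA.Term (Empty ⊕ Fin k)) (φ : LA.BoundedFormula Empty (k + 1))
    (w : Empty → ℕ) (v : Fin k → ℕ) :
    ((leF (&(Fin.last k)) (liftT t) ⊓ φ).ex).Realize w v ↔
      ∃ x ≤ t.realize (Sum.elim w v), φ.Realize w (Fin.snoc v x) := by
  simp [realize_liftT]

/-- Extension of a renaming under a quantifier. -/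
def extR {k m : ℕ} (σ : Fin k → Fin m) : Fin (k + 1) → Fin (m + 1) :=
  Fin.snoc (Fin.castSucc ∘ σ) (Fin.last m)

theorem snoc_comp_extR {k m : ℕ} (σ : Fin k → Fin m) (v : Fin m → ℕ) (x : ℕ) :
    (Fin.snoc v x : Fin (m + 1) → ℕ) ∘ extR σ = Fin.snoc (v ∘ σ) x := by
  ext i
  refine Fin.lastCases ?_ (fun i => ?_) i <;> simp [extR]

theorem extR_last {k m : ℕ} (σ : Fin k → Fin m) : extR σ (Fin.last k) = Fin.last m := by
  simp [extR]

/-- `R` is defined in `ℕ` by a formula of the class `Γ`, stably under renaming of variables. -/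
def DefBy (Γ : ∀ {k : ℕ}, LA.BoundedFormula Empty k → Prop) {k : ℕ} (R : (Fin k → ℕ) → Prop) :
    Prop :=
  ∀ (m : ℕ) (σ : Fin k → Fin m), ∃ φ : LA.BoundedFormula Empty m,
    Γ φ ∧ ∀ (w : Empty → ℕ) (v : Fin m → ℕ), φ.Realize w v ↔ R (v ∘ σ)

theorem Delta0.defBy {k : ℕ} {φ : LA.BoundedFormula Empty k} (h : Delta0 φ) :
    DefBy Delta0 (φ.Realize (default : Empty → ℕ)) := by
  induction h with
  | falsum => exact fun m σ => ⟨⊥, .falsum, fun w v => by simp⟩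
  | equal t₁ t₂ =>
    exact fun m σ => ⟨_, .equal (renT σ t₁) (renT σ t₂), fun w v => by
      simp [realize_renT, Subsingleton.elim w default]⟩
  | le t₁ t₂ =>
    exact fun m σ => ⟨_, .le (renT σ t₁) (renT σ t₂), fun w v => by
      simp [realize_renT, Subsingleton.elim w default]⟩
  | imp _ _ ih₁ ih₂ =>
    intro m σ
    obtain ⟨φ', h₁, e₁⟩ := ih₁ m σ
    obtain ⟨ψ', h₂, e₂⟩ := ih₂ m σ
    exact ⟨_, h₁.imp h₂, fun w v => by simp [e₁, e₂]⟩
  | bdall t _ ih =>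
    intro m σ
    obtain ⟨φ', h, e⟩ := ih (m + 1) (extR σ)
    refine ⟨_, h.bdall (renT σ t), fun w v => ?_⟩
    simp only [realize_bdall, e, realize_renT, snoc_comp_extR, Subsingleton.elim w default]

theorem Delta0.defBy_not {k : ℕ} {φ : LA.BoundedFormula Empty k} (h : Delta0 φ) :
    DefBy Delta0 fun v => ¬ φ.Realize (default : Empty → ℕ) v := by
  intro m σ
  obtain ⟨ψ, h', e⟩ := h.defBy m σ
  exact ⟨_, h'.imp .falsum, fun w v => by simp [e]⟩

mutual
  theorem IsSigma.defBy {n k : ℕ} {φ : LA.BoundedFormula Empty k} : IsSigma n φ →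
      DefBy (IsSigma n) (φ.Realize (default : Empty → ℕ)) ∧
        DefBy (IsPi n) fun v => ¬ φ.Realize (default : Empty → ℕ) v
    | .ofDelta0 h => by
      refine ⟨fun m σ => ?_, fun m σ => ?_⟩
      · obtain ⟨ψ, h', e⟩ := h.defBy m σ
        exact ⟨ψ, .ofDelta0 h', e⟩
      · obtain ⟨ψ, h', e⟩ := h.defBy_not m σ
        exact ⟨ψ, .ofDelta0 h', e⟩
    | .ofPi h => by
      refine ⟨fun m σ => ?_, fun m σ => ?_⟩
      · obtain ⟨ψ, h', e⟩ := h.defBy.1 m σ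
        exact ⟨ψ, .ofPi h', e⟩
      · obtain ⟨ψ, h', e⟩ := h.defBy.2 m σ
        exact ⟨ψ, .ofSigma h', e⟩
    | .ex h => by
      refine ⟨fun m σ => ?_, fun m σ => ?_⟩
      · obtain ⟨ψ, h', e⟩ := h.defBy.1 (m + 1) (extR σ)
        exact ⟨_, .ex h', fun w v => by simp [e, snoc_comp_extR]⟩
      · obtain ⟨ψ, h', e⟩ := h.defBy.2 (m + 1) (extR σ)
        exact ⟨_, .all h', fun w v => by simp [e, snoc_comp_extR]⟩
    | .inf h₁ h₂ => by
      refine ⟨fun m σ => ?_, fun m σ => ?_⟩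
      · obtain ⟨ψ₁, h₁', e₁⟩ := h₁.defBy.1 m σ
        obtain ⟨ψ₂, h₂', e₂⟩ := h₂.defBy.1 m σ
        exact ⟨_, .inf h₁' h₂', fun w v => by simp [e₁, e₂]⟩
      · obtain ⟨ψ₁, h₁', e₁⟩ := h₁.defBy.2 m σ
        obtain ⟨ψ₂, h₂', e₂⟩ := h₂.defBy.2 m σ
        exact ⟨_, .sup h₁' h₂', fun w v => by simp [e₁, e₂, imp_iff_not_or]⟩
    | .sup h₁ h₂ => by
      refine ⟨fun m σ => ?_, fun m σ => ?_⟩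
      · obtain ⟨ψ₁, h₁', e₁⟩ := h₁.defBy.1 m σ
        obtain ⟨ψ₂, h₂', e₂⟩ := h₂.defBy.1 m σ
        exact ⟨_, .sup h₁' h₂', fun w v => by simp [e₁, e₂]⟩
      · obtain ⟨ψ₁, h₁', e₁⟩ := h₁.defBy.2 m σ
        obtain ⟨ψ₂, h₂', e₂⟩ := h₂.defBy.2 m σ
        exact ⟨_, .inf h₁' h₂', fun w v => by simp [e₁, e₂]⟩
    | .bdall t h => by
      refine ⟨fun m σ => ?_, fun m σ => ?_⟩
      · obtain ⟨ψ, h', e⟩ := h.defBy.1 (m + 1) (extR σ)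
        refine ⟨_, .bdall (renT σ t) h', fun w v => ?_⟩
        simp only [realize_bdall, e, realize_renT, snoc_comp_extR, Subsingleton.elim w default]
      · obtain ⟨ψ, h', e⟩ := h.defBy.2 (m + 1) (extR σ)
        refine ⟨_, .bdex (renT σ t) h', fun w v => ?_⟩
        simp only [realize_bdall, realize_bdex, e, realize_renT, snoc_comp_extR,
          Subsingleton.elim w default]
        push Not
        rfl

  theorem IsPi.defBy {n k : ℕ} {φ : LA.BoundedFormula Empty k} : IsPi n φ →
      DefBy (IsPi n) (φ.Realize (default : Empty → ℕ)) ∧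
        DefBy (IsSigma n) fun v => ¬ φ.Realize (default : Empty → ℕ) v
    | .ofDelta0 h => by
      refine ⟨fun m σ => ?_, fun m σ => ?_⟩
      · obtain ⟨ψ, h', e⟩ := h.defBy m σ
        exact ⟨ψ, .ofDelta0 h', e⟩
      · obtain ⟨ψ, h', e⟩ := h.defBy_not m σ
        exact ⟨ψ, .ofDelta0 h', e⟩
    | .ofSigma h => by
      refine ⟨fun m σ => ?_, fun m σ => ?_⟩
      · obtain ⟨ψ, h', e⟩ := h.defBy.1 m σ
        exact ⟨ψ, .ofSigma h', e⟩
      · obtain ⟨ψ, h', e⟩ := h.defBy.2 m σ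
        exact ⟨ψ, .ofPi h', e⟩
    | .all h => by
      refine ⟨fun m σ => ?_, fun m σ => ?_⟩
      · obtain ⟨ψ, h', e⟩ := h.defBy.1 (m + 1) (extR σ)
        exact ⟨_, .all h', fun w v => by simp [e, snoc_comp_extR]⟩
      · obtain ⟨ψ, h', e⟩ := h.defBy.2 (m + 1) (extR σ)
        exact ⟨_, .ex h', fun w v => by simp [e, snoc_comp_extR]⟩
    | .inf h₁ h₂ => by
      refine ⟨fun m σ => ?_, fun m σ => ?_⟩
      · obtain ⟨ψ₁, h₁', e₁⟩ := h₁.defBy.1 m σ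
        obtain ⟨ψ₂, h₂', e₂⟩ := h₂.defBy.1 m σ
        exact ⟨_, .inf h₁' h₂', fun w v => by simp [e₁, e₂]⟩
      · obtain ⟨ψ₁, h₁', e₁⟩ := h₁.defBy.2 m σ
        obtain ⟨ψ₂, h₂', e₂⟩ := h₂.defBy.2 m σ
        exact ⟨_, .sup h₁' h₂', fun w v => by simp [e₁, e₂, imp_iff_not_or]⟩
    | .sup h₁ h₂ => by
      refine ⟨fun m σ => ?_, fun m σ => ?_⟩
      · obtain ⟨ψ₁, h₁', e₁⟩ := h₁.defBy.1 m σ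
        obtain ⟨ψ₂, h₂', e₂⟩ := h₂.defBy.1 m σ
        exact ⟨_, .sup h₁' h₂', fun w v => by simp [e₁, e₂]⟩
      · obtain ⟨ψ₁, h₁', e₁⟩ := h₁.defBy.2 m σ
        obtain ⟨ψ₂, h₂', e₂⟩ := h₂.defBy.2 m σ
        exact ⟨_, .inf h₁' h₂', fun w v => by simp [e₁, e₂]⟩
    | .bdex t h => by
      refine ⟨fun m σ => ?_, fun m σ => ?_⟩
      · obtain ⟨ψ, h', e⟩ := h.defBy.1 (m + 1) (extR σ)
        refine ⟨_, .bdex (renT σ t) h', fun w v => ?_⟩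
        simp only [realize_bdex, e, realize_renT, snoc_comp_extR, Subsingleton.elim w default]
      · obtain ⟨ψ, h', e⟩ := h.defBy.2 (m + 1) (extR σ)
        refine ⟨_, .bdall (renT σ t) h', fun w v => ?_⟩
        simp only [realize_bdall, realize_bdex, e, realize_renT, snoc_comp_extR,
          Subsingleton.elim w default]
        push Not
        rfl
end

/-- `R` is definable in `ℕ` by a `Σₙ₊₁`-formula, stably under renaming of variables. -/
def SD (n : ℕ) {k : ℕ} (R : (Fin k → ℕ) → Prop) : Prop := DefBy (IsSigma (n + 1)) R

/-- `f` is given by a term. -/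
def IsTm {k : ℕ} (f : (Fin k → ℕ) → ℕ) : Prop :=
  ∃ t : LA.Term (Empty ⊕ Fin k), ∀ (w : Empty → ℕ) v, t.realize (Sum.elim w v) = f v

/-- `f` has a `Σₙ₊₁`-definable graph. -/
def SF (n : ℕ) {k : ℕ} (f : (Fin k → ℕ) → ℕ) : Prop :=
  SD n fun v : Fin (k + 1) → ℕ => v (Fin.last k) = f (Fin.init v)

section Definability
variable {n k : ℕ}

theorem IsTm.var (i : Fin k) : IsTm fun v => v i := ⟨&i, fun _ _ => rfl⟩

theorem IsTm.const (c : ℕ) : IsTm fun _ : Fin k → ℕ => c := by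
  induction c with
  | zero => exact ⟨zeroT, fun _ _ => rfl⟩
  | succ c ih =>
    obtain ⟨t, ht⟩ := ih
    exact ⟨succT t, fun w v => by simp [ht]⟩

theorem IsTm.add {f g : (Fin k → ℕ) → ℕ} (hf : IsTm f) (hg : IsTm g) :
    IsTm fun v => f v + g v := by
  obtain ⟨t, ht⟩ := hf
  obtain ⟨s, hs⟩ := hg
  exact ⟨addT t s, fun w v => by simp [ht, hs]⟩

theorem IsTm.mul {f g : (Fin k → ℕ) → ℕ} (hf : IsTm f) (hg : IsTm g) :
    IsTm fun v => f v * g v := by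
  obtain ⟨t, ht⟩ := hf
  obtain ⟨s, hs⟩ := hg
  exact ⟨mulT t s, fun w v => by simp [ht, hs]⟩

theorem SD.congr {R S : (Fin k → ℕ) → Prop} (h : SD n R) (e : ∀ v, S v ↔ R v) : SD n S := by
  rwa [show S = R from funext fun v => propext (e v)]

theorem SD.ren {l : ℕ} {R : (Fin k → ℕ) → Prop} (h : SD n R) (σ : Fin k → Fin l) :
    SD n fun v => R (v ∘ σ) := fun m τ => h m (τ ∘ σ)

theorem SD.and {R S : (Fin k → ℕ) → Prop} (hR : SD n R) (hS : SD n S) :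
    SD n fun v => R v ∧ S v := by
  intro m σ
  obtain ⟨φ, h₁, e₁⟩ := hR m σ
  obtain ⟨ψ, h₂, e₂⟩ := hS m σ
  exact ⟨_, .inf h₁ h₂, fun w v => by simp [e₁, e₂]⟩

theorem SD.or {R S : (Fin k → ℕ) → Prop} (hR : SD n R) (hS : SD n S) :
    SD n fun v => R v ∨ S v := by
  intro m σ
  obtain ⟨φ, h₁, e₁⟩ := hR m σ
  obtain ⟨ψ, h₂, e₂⟩ := hS m σ
  exact ⟨_, .sup h₁ h₂, fun w v => by simp [e₁, e₂]⟩

theorem SD.ex {R : (Fin k → ℕ) → ℕ → Prop}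
    (h : SD n fun v : Fin (k + 1) → ℕ => R (Fin.init v) (v (Fin.last k))) :
    SD n fun v => ∃ x, R v x := by
  intro m σ
  obtain ⟨φ, h', e⟩ := h (m + 1) (extR σ)
  exact ⟨_, .ex h', fun w v => by simp [e, snoc_comp_extR, extR_last]⟩

theorem SD.ball_tm {f : (Fin k → ℕ) → ℕ} {R : (Fin k → ℕ) → ℕ → Prop} (hf : IsTm f)
    (h : SD n fun v : Fin (k + 1) → ℕ => R (Fin.init v) (v (Fin.last k))) :
    SD n fun v => ∀ x ≤ f v, R v x := by
  intro m σ
  obtain ⟨t, ht⟩ := hf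
  obtain ⟨φ, h', e⟩ := h (m + 1) (extR σ)
  refine ⟨_, .bdall (renT σ t) h', fun w v => ?_⟩
  rw [realize_bdall]
  simp [e, snoc_comp_extR, extR_last, realize_renT, ht]

theorem SD.eq_tm {f g : (Fin k → ℕ) → ℕ} (hf : IsTm f) (hg : IsTm g) :
    SD n fun v => f v = g v := by
  intro m σ
  obtain ⟨t, ht⟩ := hf
  obtain ⟨s, hs⟩ := hg
  exact ⟨_, ((Delta0.equal (renT σ t) (renT σ s)).isSigma_and_isPi _).1, fun w v => by
    simp [realize_renT, ht, hs]⟩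

theorem SD.le_tm {f g : (Fin k → ℕ) → ℕ} (hf : IsTm f) (hg : IsTm g) :
    SD n fun v => f v ≤ g v := by
  intro m σ
  obtain ⟨t, ht⟩ := hf
  obtain ⟨s, hs⟩ := hg
  exact ⟨_, ((Delta0.le (renT σ t) (renT σ s)).isSigma_and_isPi _).1, fun w v => by
    simp [realize_renT, ht, hs]⟩

theorem IsTm.init {f : (Fin k → ℕ) → ℕ} (hf : IsTm f) :
    IsTm fun v : Fin (k + 1) → ℕ => f (Fin.init v) := by
  obtain ⟨t, ht⟩ := hf
  exact ⟨renT Fin.castSucc t, fun w v => by rw [realize_renT, ht]; rfl⟩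

theorem IsTm.sf {f : (Fin k → ℕ) → ℕ} (hf : IsTm f) : SF n f := SD.eq_tm (.var _) hf.init

theorem SF.var (i : Fin k) : SF n fun v => v i := (IsTm.var i).sf

theorem SF.const (c : ℕ) : SF n fun _ : Fin k → ℕ => c := (IsTm.const c).sf

theorem SF.init {f : (Fin k → ℕ) → ℕ} (hf : SF n f) :
    SF n fun v : Fin (k + 1) → ℕ => f (Fin.init v) := by
  refine (SD.ren hf (extR Fin.castSucc)).congr fun v => ?_
  have h₁ : (v ∘ extR Fin.castSucc) (Fin.last k) = v (Fin.last (k + 1)) := by simp [extR]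
  have h₂ : (Fin.init (v ∘ extR Fin.castSucc) : Fin k → ℕ) = Fin.init (Fin.init v) := by
    ext i; simp [extR, Fin.init]
  rw [h₁, h₂]

theorem SF.comp {f : (Fin k → ℕ) → ℕ} {R : (Fin k → ℕ) → ℕ → Prop} (hf : SF n f)
    (h : SD n fun v : Fin (k + 1) → ℕ => R (Fin.init v) (v (Fin.last k))) :
    SD n fun v => R v (f v) :=
  (SD.ex (R := fun v y => y = f v ∧ R v y) (SD.and hf h)).congr fun v => by simp

theorem SD.comp₂ {f g : (Fin k → ℕ) → ℕ} {R : ℕ → ℕ → Prop} (hf : SF n f) (hg : SF n g)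
    (h : SD n fun v : Fin 2 → ℕ => R (v 0) (v 1)) : SD n fun v => R (f v) (g v) := by
  refine SF.comp (R := fun v y => R y (g v)) hf ?_
  refine SF.comp (R := fun v y => R (v (Fin.last k)) y) hg.init ?_
  exact (h.ren ![(Fin.last k).castSucc, Fin.last (k + 1)]).congr fun v => Iff.rfl

theorem SF.comp₂ {f g : (Fin k → ℕ) → ℕ} {F : ℕ → ℕ → ℕ} (hf : SF n f) (hg : SF n g)
    (h : SD n fun v : Fin 3 → ℕ => v 2 = F (v 0) (v 1)) : SF n fun v => F (f v) (g v) := by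
  refine SF.comp (R := fun v y => v (Fin.last k) = F y (g (Fin.init v))) hf.init ?_
  refine SF.comp (R := fun v y => v (Fin.last k).castSucc = F (v (Fin.last _)) y)
    hg.init.init ?_
  exact (h.ren ![(Fin.last (k + 1)).castSucc, Fin.last (k + 2),
    (Fin.last k).castSucc.castSucc]).congr fun v => Iff.rfl

/-- The set `A` is `Σₙ₊₁`-definable. -/
def SP (n : ℕ) (A : ℕ → Prop) : Prop := SD n fun v : Fin 1 → ℕ => A (v 0)

theorem SP.comp {A : ℕ → Prop} (h : SP n A) {f : (Fin k → ℕ) → ℕ} (hf : SF n f) :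
    SD n fun v => A (f v) :=
  SF.comp (R := fun _ y => A y) hf ((SD.ren h fun _ => Fin.last k).congr fun _ => Iff.rfl)

theorem SD.eq {f g : (Fin k → ℕ) → ℕ} (hf : SF n f) (hg : SF n g) : SD n fun v => f v = g v :=
  SD.comp₂ hf hg (.eq_tm (.var 0) (.var 1))

theorem SD.le {f g : (Fin k → ℕ) → ℕ} (hf : SF n f) (hg : SF n g) : SD n fun v => f v ≤ g v :=
  SD.comp₂ hf hg (.le_tm (.var 0) (.var 1))

theorem SF.add {f g : (Fin k → ℕ) → ℕ} (hf : SF n f) (hg : SF n g) : SF n fun v => f v + g v :=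
  SF.comp₂ hf hg (.eq_tm (.var 2) (.add (.var 0) (.var 1)))

theorem SF.mul {f g : (Fin k → ℕ) → ℕ} (hf : SF n f) (hg : SF n g) : SF n fun v => f v * g v :=
  SF.comp₂ hf hg (.eq_tm (.var 2) (.mul (.var 0) (.var 1)))

theorem SD.lt {f g : (Fin k → ℕ) → ℕ} (hf : SF n f) (hg : SF n g) : SD n fun v => f v < g v :=
  SD.le (hf.add (.const 1)) hg

theorem SD.ball {f : (Fin k → ℕ) → ℕ} {R : (Fin k → ℕ) → ℕ → Prop} (hf : SF n f)
    (h : SD n fun v : Fin (k + 1) → ℕ => R (Fin.init v) (v (Fin.last k))) :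
    SD n fun v => ∀ x ≤ f v, R v x := by
  refine SF.comp (R := fun v y => ∀ x ≤ y, R v x) hf ?_
  refine SD.ball_tm (R := fun v x => R (Fin.init v) x) (.var _) ?_
  refine (h.ren (extR Fin.castSucc)).congr fun v => ?_
  have h₁ : (v ∘ extR Fin.castSucc) (Fin.last k) = v (Fin.last (k + 1)) := by simp [extR]
  have h₂ : (Fin.init (v ∘ extR Fin.castSucc) : Fin k → ℕ) = Fin.init (Fin.init v) := by
    ext i; simp [extR, Fin.init]
  rw [h₁, h₂]

theorem SF.pair {f g : (Fin k → ℕ) → ℕ} (hf : SF n f) (hg : SF n g) :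
    SF n fun v => Nat.pair (f v) (g v) := by
  refine SF.comp₂ hf hg (SD.congr (R := fun v => (v 0 < v 1 ∧ v 2 = v 1 * v 1 + v 0) ∨
    (v 1 ≤ v 0 ∧ v 2 = v 0 * v 0 + v 0 + v 1)) ?_ fun v => ?_)
  · exact .or (.and (.lt (.var 0) (.var 1)) (.eq (.var 2) (.add (.mul (.var 1) (.var 1)) (.var 0))))
      (.and (.le (.var 1) (.var 0))
        (.eq (.var 2) (.add (.add (.mul (.var 0) (.var 0)) (.var 0)) (.var 1))))
  · rw [Nat.pair]
    split_ifs with h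
    · simp [h]
    · simp [h, not_lt.1 h]

theorem SF.mod_succ {f g : (Fin k → ℕ) → ℕ} (hf : SF n f) (hg : SF n g) :
    SF n fun v => f v % (g v + 1) := by
  refine SF.comp₂ (F := fun a b => a % (b + 1)) hf hg
    (SD.congr (R := fun v => v 2 ≤ v 1 ∧ ∃ q, v 0 = q * (v 1 + 1) + v 2) ?_ fun v => ?_)
  · refine .and (.le (.var 2) (.var 1)) (SD.ex ?_)
    exact .eq (.var 0) (.add (.mul (.var (Fin.last 3)) (.add (.var 1) (.const 1))) (.var 2))
  · constructor
    · intro h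
      rw [h]
      exact ⟨Nat.le_of_lt_succ (Nat.mod_lt _ (Nat.succ_pos _)), v 0 / (v 1 + 1),
        (Nat.div_add_mod' _ _).symm⟩
    · rintro ⟨h, q, hq⟩
      rw [hq, Nat.mul_add_mod_of_lt (b := v 1 + 1) (Nat.lt_succ_of_le h)]

end Definability

/-! ### Inductively generated sets -/

/-- The set generated by axioms `A` and rules `J` with two premises. -/
inductive Der (A : ℕ → Prop) (J : ℕ → ℕ → ℕ → Prop) : ℕ → Prop
  | ax {x : ℕ} : A x → Der A J x
  | step {x y z : ℕ} : J x y z → Der A J y → Der A J z → Der A J x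

/-- `l` lists elements each of which is an axiom or follows from later ones. -/
def IsDer (A : ℕ → Prop) (J : ℕ → ℕ → ℕ → Prop) : List ℕ → Prop
  | [] => True
  | x :: l => (A x ∨ ∃ y ∈ l, ∃ z ∈ l, J x y z) ∧ IsDer A J l

section Der
variable {A : ℕ → Prop} {J : ℕ → ℕ → ℕ → Prop}

theorem IsDer.append {l m : List ℕ} (hl : IsDer A J l) (hm : IsDer A J m) :
    IsDer A J (l ++ m) := by
  induction l with
  | nil => exact hm
  | cons x l ih =>
    refine ⟨hl.1.imp_right ?_, ih hl.2⟩
    rintro ⟨y, hy, z, hz, h⟩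
    exact ⟨y, List.mem_append_left _ hy, z, List.mem_append_left _ hz, h⟩

theorem Der.exists_list {x : ℕ} (h : Der A J x) : ∃ l, IsDer A J (x :: l) := by
  induction h with
  | ax h => exact ⟨[], .inl h, trivial⟩
  | @step x y z h _ _ ih₁ ih₂ =>
    obtain ⟨l, hl⟩ := ih₁
    obtain ⟨m, hm⟩ := ih₂
    exact ⟨(y :: l) ++ (z :: m), .inr ⟨y, by simp, z, by simp, h⟩, hl.append hm⟩

theorem IsDer.getElem {l : List ℕ} (hl : IsDer A J l) (i : ℕ) (hi : i < l.length) :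
    A l[i] ∨ ∃ j, ∃ hj : j < l.length, ∃ m, ∃ hm : m < l.length, i < j ∧ i < m ∧ J l[i] l[j] l[m] := by
  induction l generalizing i with
  | nil => simp at hi
  | cons x l ih =>
    cases i with
    | zero =>
      refine hl.1.imp_right ?_
      rintro ⟨y, hy, z, hz, h⟩
      obtain ⟨j, hj, rfl⟩ := List.getElem_of_mem hy
      obtain ⟨m, hm, rfl⟩ := List.getElem_of_mem hz
      exact ⟨j + 1, by simpa using hj, m + 1, by simpa using hm, by omega, by omega, h⟩
    | succ i =>
      refine (ih hl.2 i (by simpa using hi)).imp_right ?_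
      rintro ⟨j, hj, m, hm, h₁, h₂, h⟩
      exact ⟨j + 1, by simpa using hj, m + 1, by simpa using hm, by omega, by omega, h⟩

theorem der_iff_beta {x : ℕ} : Der A J x ↔ ∃ a b N, x = a % ((0 + 1) * b + 1) ∧ ∀ i ≤ N,
    A (a % ((i + 1) * b + 1)) ∨ ∃ j, j ≤ N ∧ ∃ m, m ≤ N ∧ i < j ∧ i < m ∧
      J (a % ((i + 1) * b + 1)) (a % ((j + 1) * b + 1)) (a % ((m + 1) * b + 1)) := by
  constructor
  · intro h
    obtain ⟨l, hl⟩ := h.exists_list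
    have hb : ∀ i (hi : i < (x :: l).length), (Nat.unbeta (x :: l)).unpair.1 %
        ((i + 1) * (Nat.unbeta (x :: l)).unpair.2 + 1) = (x :: l)[i] := fun i hi =>
      Nat.beta_unbeta_coe (x :: l) ⟨i, hi⟩
    refine ⟨_, _, l.length, (hb 0 (by simp)).symm, fun i hi => ?_⟩
    rw [hb i (by simpa using Nat.lt_succ_of_le hi)]
    refine (hl.getElem i _).imp_right ?_
    rintro ⟨j, hj, m, hm, h₁, h₂, h⟩
    refine ⟨j, by simpa [Nat.lt_succ_iff] using hj, m, by simpa [Nat.lt_succ_iff] using hm,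
      h₁, h₂, ?_⟩
    rwa [hb j hj, hb m hm]
  · rintro ⟨a, b, N, hx, H⟩
    have key : ∀ d i, i ≤ N → N - i = d → Der A J (a % ((i + 1) * b + 1)) := by
      intro d
      induction d using Nat.strong_induction_on with
      | _ d ih =>
        intro i hi hd
        obtain h | ⟨j, hj, m, hm, h₁, h₂, h⟩ := H i hi
        · exact .ax h
        · exact .step h (ih _ (by omega) j hj rfl) (ih _ (by omega) m hm rfl)
    rw [hx]
    exact key _ 0 (Nat.zero_le _) rfl

theorem Der.sp {n : ℕ} (hA : SP n A)
    (hJ : ∀ {k : ℕ} {f g h : (Fin k → ℕ) → ℕ}, SF n f → SF n g → SF n h →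
      SD n fun v => J (f v) (g v) (h v)) : SP n (Der A J) := by
  refine SD.congr ?_ fun v => der_iff_beta
  refine .ex (.ex (.ex (.and (.eq (.var 0) (.mod_succ (.var 1)
    (.mul (.add (.const 0) (.const 1)) (.var 2)))) ?_)))
  have hb {k : ℕ} {f g h : (Fin k → ℕ) → ℕ} (hf : SF n f) (hg : SF n g) (hh : SF n h) :
      SF n fun v => f v % ((h v + 1) * g v + 1) :=
    .mod_succ hf (.mul (.add hh (.const 1)) hg)
  refine .ball (.var 3) (.or (hA.comp (hb (.var 1) (.var 2) (.var 4))) ?_)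
  refine .ex (.and (.le (.var 5) (.var 3)) (.ex (.and (.le (.var 6) (.var 3)) ?_)))
  exact .and (.lt (.var 4) (.var 5)) (.and (.lt (.var 4) (.var 6))
    (hJ (hb (.var 1) (.var 2) (.var 4)) (hb (.var 1) (.var 2) (.var 5))
      (hb (.var 1) (.var 2) (.var 6))))

end Der

/-! ### Codes of terms and formulas -/

/-- Code of a nonempty list with head `x` and tail coded by `a`; the empty list has code `0`. -/
def cons (x a : ℕ) : ℕ := Nat.pair x a + 1

/-- Code of a syntactic node with tag `i` and data `x`. -/
def node (i x : ℕ) : ℕ := Nat.pair i x + 1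

/-- The most recently bound variable. -/
def cHd : ℕ := node 0 0
/-- The numeral of `e`. -/
def cNum (e : ℕ) : ℕ := node 1 e
/-- Weakening of a term by one variable. -/
def cWk (t : ℕ) : ℕ := node 2 t
/-- Code of a successor. -/
def cSucc (t : ℕ) : ℕ := node 3 t
/-- Code of a sum. -/
def cAdd (t s : ℕ) : ℕ := node 4 (Nat.pair t s)
/-- Code of a product. -/
def cMul (t s : ℕ) : ℕ := node 5 (Nat.pair t s)
/-- Code of falsity. -/
def cFls : ℕ := node 6 0
/-- Code of an equation. -/
def cEq (t s : ℕ) : ℕ := node 7 (Nat.pair t s)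
/-- Code of an inequality. -/
def cLe (t s : ℕ) : ℕ := node 8 (Nat.pair t s)
/-- Code of an implication. -/
def cImp (t s : ℕ) : ℕ := node 9 (Nat.pair t s)
/-- Code of a universal quantification. -/
def cAll (t : ℕ) : ℕ := node 10 t

/-- `c` codes the term `t` in context `k`. -/
inductive TC : ℕ → ∀ k : ℕ, LA.Term (Empty ⊕ Fin k) → Prop
  | hd (k : ℕ) : TC cHd (k + 1) (&(Fin.last k))
  | wk {c k : ℕ} {t : LA.Term (Empty ⊕ Fin k)} : TC c k t → TC (cWk c) (k + 1) (liftT t)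
  | zero (k : ℕ) : TC (cNum 0) k zeroT
  | succ {c k : ℕ} {t : LA.Term (Empty ⊕ Fin k)} : TC c k t → TC (cSucc c) k (succT t)
  | add {c d k : ℕ} {t s : LA.Term (Empty ⊕ Fin k)} :
      TC c k t → TC d k s → TC (cAdd c d) k (addT t s)
  | mul {c d k : ℕ} {t s : LA.Term (Empty ⊕ Fin k)} :
      TC c k t → TC d k s → TC (cMul c d) k (mulT t s)

/-- `c` codes the formula `φ` in context `k`. -/
inductive FC : ℕ → ∀ k : ℕ, LA.BoundedFormula Empty k → Prop
  | fls (k : ℕ) : FC cFls k ⊥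
  | eq {c d k : ℕ} {t s : LA.Term (Empty ⊕ Fin k)} : TC c k t → TC d k s → FC (cEq c d) k (t =' s)
  | le {c d k : ℕ} {t s : LA.Term (Empty ⊕ Fin k)} : TC c k t → TC d k s → FC (cLe c d) k (leF t s)
  | imp {c d k : ℕ} {φ ψ : LA.BoundedFormula Empty k} :
      FC c k φ → FC d k ψ → FC (cImp c d) k (φ ⟹ ψ)
  | all {c k : ℕ} {φ : LA.BoundedFormula Empty (k + 1)} : FC c (k + 1) φ → FC (cAll c) k φ.all

theorem exists_tc_var (k : ℕ) (i : Fin k) : ∃ c, TC c k (&i) := by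
  induction k with
  | zero => exact i.elim0
  | succ k ih =>
    refine Fin.lastCases ⟨_, .hd k⟩ (fun i => ?_) i
    obtain ⟨c, hc⟩ := ih i
    exact ⟨_, hc.wk⟩

theorem exists_tc {k : ℕ} (t : LA.Term (Empty ⊕ Fin k)) : ∃ c, TC c k t := by
  induction t with
  | var x =>
    obtain x | i := x
    · exact x.elim
    · exact exists_tc_var k i
  | func f ts ih =>
    change ArithFunc _ at f
    cases f with
    | zero =>
      rw [Subsingleton.elim ts (![])]
      exact ⟨_, .zero k⟩
    | succ =>
      obtain ⟨c, hc⟩ := ih 0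
      have e : ts = ![ts 0] := by ext i; fin_cases i; rfl
      rw [e]
      exact ⟨_, hc.succ⟩
    | add =>
      obtain ⟨c, hc⟩ := ih 0
      obtain ⟨d, hd⟩ := ih 1
      have e : ts = ![ts 0, ts 1] := by ext i; fin_cases i <;> rfl
      rw [e]
      exact ⟨_, hc.add hd⟩
    | mul =>
      obtain ⟨c, hc⟩ := ih 0
      obtain ⟨d, hd⟩ := ih 1
      have e : ts = ![ts 0, ts 1] := by ext i; fin_cases i <;> rfl
      rw [e]
      exact ⟨_, hc.mul hd⟩

theorem exists_fc {k : ℕ} (φ : LA.BoundedFormula Empty k) : ∃ c, FC c k φ := by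
  induction φ with
  | falsum => exact ⟨_, .fls _⟩
  | equal t s =>
    obtain ⟨c, hc⟩ := exists_tc t
    obtain ⟨d, hd⟩ := exists_tc s
    exact ⟨_, .eq hc hd⟩
  | rel R ts =>
    change ArithRel _ at R
    cases R
    obtain ⟨c, hc⟩ := exists_tc (ts 0)
    obtain ⟨d, hd⟩ := exists_tc (ts 1)
    have e : ts = ![ts 0, ts 1] := by ext i; fin_cases i <;> rfl
    rw [e]
    exact ⟨_, .le hc hd⟩
  | imp _ _ ih₁ ih₂ =>
    obtain ⟨c, hc⟩ := ih₁
    obtain ⟨d, hd⟩ := ih₂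
    exact ⟨_, .imp hc hd⟩
  | all _ ih =>
    obtain ⟨c, hc⟩ := ih
    exact ⟨_, .all hc⟩

/-! ### Comparison with the Gödel numbering -/

/-- Code of the symbols of a term followed by the list coded by `r`. -/
def encT {k : ℕ} (t : LA.Term (Empty ⊕ Fin k)) (r : ℕ) : ℕ :=
  (t.listEncode.map Encodable.encode).foldr cons r

/-- Code of the symbols of a formula followed by the list coded by `r`. -/
def encF {k : ℕ} (φ : LA.BoundedFormula Empty k) (r : ℕ) : ℕ :=
  (φ.listEncode.map Encodable.encode).foldr cons r

theorem encode_eq_foldr {α : Type} [Encodable α] (l : List α) :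
    Encodable.encode l = (l.map Encodable.encode).foldr cons 0 := by
  induction l with
  | nil => rfl
  | cons a l ih => rw [Encodable.encode_list_cons, ih]; rfl

theorem godel_eq_encF {k : ℕ} (φ : LA.BoundedFormula Empty k) : godel φ = encF φ 0 :=
  encode_eq_foldr _

theorem encode_term {k : ℕ} (t : LA.Term (Empty ⊕ Fin k)) : Encodable.encode t = encT t 0 :=
  encode_eq_foldr t.listEncode

theorem encT_liftT {k : ℕ} (t : LA.Term (Empty ⊕ Fin k)) (r : ℕ) :
    encT (liftT t) r = encT t r := by
  have h : (liftT t).listEncode.map Encodable.encode = t.listEncode.map Encodable.encode := by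
    induction t with
    | var x =>
      obtain x | i := x
      · exact x.elim
      · rfl
    | func f ts ih =>
      simp only [liftT, Term.relabel, Term.listEncode, List.map_cons, List.map_flatMap] at ih ⊢
      exact congrArg₂ List.cons rfl
        (congrArg (fun F => (List.finRange _).flatMap F) (funext ih))
  rw [encT, h, encT]

theorem encT_succ {k : ℕ} (t : LA.Term (Empty ⊕ Fin k)) (r : ℕ) :
    encT (succT t) r = cons 3 (encT t r) := by
  simp only [encT, succT, Term.listEncode, List.map_cons, List.foldr_cons, List.finRange_succ,
    List.finRange_zero, List.flatMap_cons, List.map_nil, List.flatMap_nil, List.append_nil]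
  rfl

theorem encT_add {k : ℕ} (t s : LA.Term (Empty ⊕ Fin k)) (r : ℕ) :
    encT (addT t s) r = cons 5 (encT t (encT s r)) := by
  simp only [encT, addT, Term.listEncode, List.map_cons, List.foldr_cons, List.finRange_succ,
    List.finRange_zero, List.flatMap_cons, List.map_nil, List.flatMap_nil, List.append_nil,
    List.map_append, List.foldr_append]
  rfl

theorem encT_mul {k : ℕ} (t s : LA.Term (Empty ⊕ Fin k)) (r : ℕ) :
    encT (mulT t s) r = cons 7 (encT t (encT s r)) := by
  simp only [encT, mulT, Term.listEncode, List.map_cons, List.foldr_cons, List.finRange_succ,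
    List.finRange_zero, List.flatMap_cons, List.map_nil, List.flatMap_nil, List.append_nil,
    List.map_append, List.foldr_append]
  rfl

theorem encF_fls {k : ℕ} (r : ℕ) :
    encF (⊥ : LA.BoundedFormula Empty k) r = cons (4 * (k + 2) + 3) r := by
  change cons (2 * (2 * (k + 2) + 1) + 1) r = _
  congr 1
  ring

theorem encF_eq {k : ℕ} (t s : LA.Term (Empty ⊕ Fin k)) (r : ℕ) : encF (t =' s) r =
    cons (2 * Nat.pair k (encT t 0)) (cons (2 * Nat.pair k (encT s 0)) r) := by
  rw [← encode_term, ← encode_term]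
  rfl

theorem encF_le {k : ℕ} (t s : LA.Term (Empty ⊕ Fin k)) (r : ℕ) : encF (leF t s) r =
    cons 1 (cons (4 * k + 3)
      (cons (2 * Nat.pair k (encT t 0)) (cons (2 * Nat.pair k (encT s 0)) r))) := by
  rw [← encode_term, ← encode_term, show 4 * k + 3 = 2 * (2 * k + 1) + 1 by ring]
  rfl

theorem encF_imp {k : ℕ} (φ ψ : LA.BoundedFormula Empty k) (r : ℕ) :
    encF (φ ⟹ ψ) r = cons 3 (encF φ (encF ψ r)) := by
  simp only [encF, listEncode, List.cons_append, List.map_cons, List.map_append, List.foldr_cons,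
    List.foldr_append]
  rfl

theorem encF_all {k : ℕ} (φ : LA.BoundedFormula Empty (k + 1)) (r : ℕ) :
    encF φ.all r = cons 7 (encF φ r) := rfl

/-- Code of the judgement that the symbols of the term (`b = 0`) or formula (`b = 1`) with code `c`
in context `k`, followed by the list `r`, form the list `L`. -/
def judg (b c k L r : ℕ) : ℕ := Nat.pair b (Nat.pair c (Nat.pair k (Nat.pair L r)))

/-- Axioms for the judgements `judg`. -/
def EncAx (x : ℕ) : Prop := ∃ k r, x = judg 0 cHd (k + 1) (cons (2 * (2 * k + 1)) r) r ∨
  x = judg 0 (cNum 0) k (cons 1 r) r ∨ x = judg 1 cFls k (cons (4 * (k + 2) + 3) r) r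

/-- Instances of the rules for the judgements `judg`, each with its two premises. -/
def encRules (t s k L M r : ℕ) : List (ℕ × ℕ × ℕ) :=
  [(judg 0 (cWk t) (k + 1) L r, judg 0 t k L r, judg 0 t k L r),
   (judg 0 (cSucc t) k (cons 3 L) r, judg 0 t k L r, judg 0 t k L r),
   (judg 0 (cAdd t s) k (cons 5 L) r, judg 0 t k L M, judg 0 s k M r),
   (judg 0 (cMul t s) k (cons 7 L) r, judg 0 t k L M, judg 0 s k M r),
   (judg 1 (cEq t s) k (cons (2 * Nat.pair k L) (cons (2 * Nat.pair k M) r)) r,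
     judg 0 t k L 0, judg 0 s k M 0),
   (judg 1 (cLe t s) k
     (cons 1 (cons (4 * k + 3) (cons (2 * Nat.pair k L) (cons (2 * Nat.pair k M) r)))) r,
     judg 0 t k L 0, judg 0 s k M 0),
   (judg 1 (cImp t s) k (cons 3 L) r, judg 1 t k L M, judg 1 s k M r),
   (judg 1 (cAll t) k (cons 7 L) r, judg 1 t (k + 1) L r, judg 1 t (k + 1) L r)]

/-- The rules for the judgements `judg`. -/
def EncRule (x y z : ℕ) : Prop := ∃ t s k L M r, (x, y, z) ∈ encRules t s k L M r

/-- Derivable judgements. -/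
def EncDer : ℕ → Prop := Der EncAx EncRule

theorem TC.encDer {c k : ℕ} {t : LA.Term (Empty ⊕ Fin k)} (h : TC c k t) (r : ℕ) :
    EncDer (judg 0 c k (encT t r) r) := by
  induction h generalizing r with
  | hd k => exact .ax ⟨k, r, .inl rfl⟩
  | @wk c k t _ ih =>
    rw [encT_liftT]
    exact .step ⟨c, 0, k, encT t r, 0, r, by simp [encRules]⟩ (ih r) (ih r)
  | zero k => exact .ax ⟨k, r, .inr (.inl rfl)⟩
  | @succ c k t _ ih =>
    rw [encT_succ]
    exact .step ⟨c, 0, k, encT t r, 0, r, by simp [encRules]⟩ (ih r) (ih r)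
  | @add c d k t s _ _ ih₁ ih₂ =>
    rw [encT_add]
    exact .step ⟨c, d, k, encT t (encT s r), encT s r, r, by simp [encRules]⟩
      (ih₁ (encT s r)) (ih₂ r)
  | @mul c d k t s _ _ ih₁ ih₂ =>
    rw [encT_mul]
    exact .step ⟨c, d, k, encT t (encT s r), encT s r, r, by simp [encRules]⟩
      (ih₁ (encT s r)) (ih₂ r)

theorem FC.encDer {c k : ℕ} {φ : LA.BoundedFormula Empty k} (h : FC c k φ) (r : ℕ) :
    EncDer (judg 1 c k (encF φ r) r) := by
  induction h generalizing r with
  | fls k =>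
    rw [encF_fls]
    exact .ax ⟨k, r, .inr (.inr rfl)⟩
  | @eq c d k t s h₁ h₂ =>
    rw [encF_eq]
    exact .step ⟨c, d, k, encT t 0, encT s 0, r, by simp [encRules]⟩ (h₁.encDer 0) (h₂.encDer 0)
  | @le c d k t s h₁ h₂ =>
    rw [encF_le]
    exact .step ⟨c, d, k, encT t 0, encT s 0, r, by simp [encRules]⟩ (h₁.encDer 0) (h₂.encDer 0)
  | @imp c d k φ ψ _ _ ih₁ ih₂ =>
    rw [encF_imp]
    exact .step ⟨c, d, k, encF φ (encF ψ r), encF ψ r, r, by simp [encRules]⟩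
      (ih₁ (encF ψ r)) (ih₂ r)
  | @all c k φ _ ih =>
    rw [encF_all]
    exact .step ⟨c, 0, k, encF φ r, 0, r, by simp [encRules]⟩ (ih r) (ih r)

theorem judg_inj {b c k L r b' c' k' L' r' : ℕ} :
    judg b c k L r = judg b' c' k' L' r' ↔ b = b' ∧ c = c' ∧ k = k' ∧ L = L' ∧ r = r' := by
  simp [judg, Nat.pair_eq_pair]

/-- The meaning of the judgement coded by `x`. -/
def EncSem (x : ℕ) : Prop :=
  (∃ c k t r, TC c k t ∧ x = judg 0 c k (encT t r) r) ∨
    ∃ c k φ r, FC c k φ ∧ x = judg 1 c k (encF φ r) r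

theorem EncSem.term {c k L r : ℕ} (h : EncSem (judg 0 c k L r)) :
    ∃ t, TC c k t ∧ L = encT t r := by
  obtain ⟨c', k', t, r', h, e⟩ | ⟨c', k', φ, r', h, e⟩ := h
  · obtain ⟨_, rfl, rfl, rfl, rfl⟩ := judg_inj.1 e
    exact ⟨t, h, rfl⟩
  · simp [judg_inj] at e

theorem EncSem.form {c k L r : ℕ} (h : EncSem (judg 1 c k L r)) :
    ∃ φ, FC c k φ ∧ L = encF φ r := by
  obtain ⟨c', k', t, r', h, e⟩ | ⟨c', k', φ, r', h, e⟩ := h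
  · simp [judg_inj] at e
  · obtain ⟨_, rfl, rfl, rfl, rfl⟩ := judg_inj.1 e
    exact ⟨φ, h, rfl⟩

theorem EncDer.sem {x : ℕ} (h : EncDer x) : EncSem x := by
  induction h with
  | ax h =>
    obtain ⟨k, r, rfl | rfl | rfl⟩ := h
    · exact .inl ⟨_, _, _, r, .hd k, rfl⟩
    · exact .inl ⟨_, _, _, r, .zero k, rfl⟩
    · exact .inr ⟨_, _, _, r, .fls k, by rw [encF_fls]⟩
  | step h _ _ ih₁ ih₂ =>
    obtain ⟨t, s, k, L, M, r, h⟩ := h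
    simp only [encRules, List.mem_cons, Prod.mk.injEq, List.not_mem_nil, or_false] at h
    obtain ⟨rfl, rfl, rfl⟩ | ⟨rfl, rfl, rfl⟩ | ⟨rfl, rfl, rfl⟩ | ⟨rfl, rfl, rfl⟩ | ⟨rfl, rfl, rfl⟩ |
      ⟨rfl, rfl, rfl⟩ | ⟨rfl, rfl, rfl⟩ | ⟨rfl, rfl, rfl⟩ := h
    · obtain ⟨t, h₁, rfl⟩ := ih₁.term
      exact .inl ⟨_, _, _, r, h₁.wk, by rw [encT_liftT]⟩
    · obtain ⟨t, h₁, rfl⟩ := ih₁.term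
      exact .inl ⟨_, _, _, r, h₁.succ, by rw [encT_succ]⟩
    · obtain ⟨t, h₁, rfl⟩ := ih₁.term
      obtain ⟨s, h₂, rfl⟩ := ih₂.term
      exact .inl ⟨_, _, _, r, h₁.add h₂, by rw [encT_add]⟩
    · obtain ⟨t, h₁, rfl⟩ := ih₁.term
      obtain ⟨s, h₂, rfl⟩ := ih₂.term
      exact .inl ⟨_, _, _, r, h₁.mul h₂, by rw [encT_mul]⟩
    · obtain ⟨t, h₁, rfl⟩ := ih₁.term
      obtain ⟨s, h₂, rfl⟩ := ih₂.term
      exact .inr ⟨_, _, _, r, FC.eq h₁ h₂, by rw [encF_eq]⟩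
    · obtain ⟨t, h₁, rfl⟩ := ih₁.term
      obtain ⟨s, h₂, rfl⟩ := ih₂.term
      exact .inr ⟨_, _, _, r, FC.le h₁ h₂, by rw [encF_le]⟩
    · obtain ⟨t, h₁, rfl⟩ := ih₁.form
      obtain ⟨s, h₂, rfl⟩ := ih₂.form
      exact .inr ⟨_, _, _, r, h₁.imp h₂, by rw [encF_imp]⟩
    · obtain ⟨t, h₁, rfl⟩ := ih₁.form
      exact .inr ⟨_, _, _, r, h₁.all, by rw [encF_all]⟩

theorem godel_injective {k : ℕ} :
    Function.Injective (godel : LA.BoundedFormula Empty k → ℕ) := by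
  intro φ ψ h
  have := listEncode_sigma_injective (L := LA) (a₁ := ⟨k, φ⟩) (a₂ := ⟨k, ψ⟩)
    (Encodable.encode_injective h)
  simpa using this

/-- The code `c` denotes a formula in context `k` whose Gödel number is `m`. -/
def FEnc (c k m : ℕ) : Prop := EncDer (judg 1 c k m 0)

theorem fEnc_godel_iff {c k : ℕ} {φ : LA.BoundedFormula Empty k} :
    FEnc c k (godel φ) ↔ FC c k φ := by
  constructor
  · intro h
    obtain ⟨ψ, h₁, h₂⟩ := (EncDer.sem h).form
    rw [← godel_eq_encF] at h₂
    rwa [godel_injective h₂]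
  · intro h
    rw [FEnc, godel_eq_encF]
    exact h.encDer 0

section Definability
variable {n k : ℕ} {f g : (Fin k → ℕ) → ℕ}

theorem SF.cons (hf : SF n f) (hg : SF n g) : SF n fun v => cons (f v) (g v) :=
  .add (.pair hf hg) (.const 1)

theorem SF.node (i : ℕ) (hf : SF n f) : SF n fun v => node i (f v) :=
  .add (.pair (.const i) hf) (.const 1)

theorem SF.cNum (hf : SF n f) : SF n fun v => cNum (f v) := .node 1 hf
theorem SF.cWk (hf : SF n f) : SF n fun v => cWk (f v) := .node 2 hf
theorem SF.cSucc (hf : SF n f) : SF n fun v => cSucc (f v) := .node 3 hf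
theorem SF.cAll (hf : SF n f) : SF n fun v => cAll (f v) := .node 10 hf
theorem SF.cAdd (hf : SF n f) (hg : SF n g) : SF n fun v => cAdd (f v) (g v) :=
  .node 4 (.pair hf hg)
theorem SF.cMul (hf : SF n f) (hg : SF n g) : SF n fun v => cMul (f v) (g v) :=
  .node 5 (.pair hf hg)
theorem SF.cEq (hf : SF n f) (hg : SF n g) : SF n fun v => cEq (f v) (g v) :=
  .node 7 (.pair hf hg)
theorem SF.cLe (hf : SF n f) (hg : SF n g) : SF n fun v => cLe (f v) (g v) :=
  .node 8 (.pair hf hg)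
theorem SF.cImp (hf : SF n f) (hg : SF n g) : SF n fun v => cImp (f v) (g v) :=
  .node 9 (.pair hf hg)

theorem SF.judg {b c l L r : (Fin k → ℕ) → ℕ} (hb : SF n b) (hc : SF n c) (hl : SF n l)
    (hL : SF n L) (hr : SF n r) : SF n fun v => judg (b v) (c v) (l v) (L v) (r v) :=
  .pair hb (.pair hc (.pair hl (.pair hL hr)))

theorem encDer_sp : SP n EncDer := by
  refine Der.sp ?_ fun {k f g h} hf hg hh => ?_
  · refine .ex (.ex ?_)
    repeat' with_reducible first
      | exact SF.const _ | apply SD.or | apply SD.eq | apply SF.judg | apply SF.cons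
      | apply SF.add | apply SF.mul
    all_goals exact SF.var _
  · simp only [EncRule, encRules, List.mem_cons, Prod.mk.injEq, List.not_mem_nil, or_false]
    refine .ex (.ex (.ex (.ex (.ex (.ex ?_)))))
    have hf' := hf.init.init.init.init.init.init
    have hg' := hg.init.init.init.init.init.init
    have hh' := hh.init.init.init.init.init.init
    repeat' with_reducible first
      | exact SF.const _ | exact hf' | exact hg' | exact hh'
      | apply SD.or | apply SD.and | apply SD.eq | apply SF.judg | apply SF.cons | apply SF.cWk
      | apply SF.cSucc | apply SF.cAdd | apply SF.cMul | apply SF.cEq | apply SF.cLe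
      | apply SF.cImp | apply SF.cAll | apply SF.add | apply SF.mul | apply SF.pair
    all_goals exact SF.var _

theorem SD.fEnc {c l m : (Fin k → ℕ) → ℕ} (hc : SF n c) (hl : SF n l) (hm : SF n m) :
    SD n fun v => FEnc (c v) (l v) (m v) :=
  encDer_sp.comp (.judg (.const 1) hc hl hm (.const 0))

end Definability

/-! ### A refutation system -/

/-- The list coded by a number. -/
def dl : ℕ → List ℕ
  | 0 => []
  | n + 1 => n.unpair.1 :: dl n.unpair.2
decreasing_by exact Nat.lt_succ_of_le (Nat.unpair_right_le n)

theorem dl_zero : dl 0 = [] := by rw [dl]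

theorem dl_cons (x a : ℕ) : dl (cons x a) = x :: dl a := by
  rw [cons, dl, Nat.unpair_pair]

theorem lt_of_mem_dl {x a : ℕ} (h : x ∈ dl a) : x < a := by
  induction a using Nat.strong_induction_on with
  | _ a ih =>
    cases a with
    | zero => simp [dl_zero] at h
    | succ a =>
      rw [dl, List.mem_cons] at h
      obtain rfl | h := h
      · exact Nat.lt_succ_of_le (Nat.unpair_left_le a)
      · have := Nat.unpair_right_le a
        have := ih _ (by omega) h
        omega

theorem mem_dl_iff {l a : ℕ} : l ∈ dl a ↔ Der (fun x => ∃ l r, x = Nat.pair l (cons l r))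
    (fun x y z => ∃ l d r, x = Nat.pair l (cons d r) ∧ y = Nat.pair l r ∧ z = Nat.pair l r)
    (Nat.pair l a) := by
  constructor
  · intro h
    induction a using Nat.strong_induction_on with
    | _ a ih =>
      cases a with
      | zero => simp [dl_zero] at h
      | succ a =>
        have e : a + 1 = cons a.unpair.1 a.unpair.2 := by simp [cons]
        rw [dl, List.mem_cons] at h
        obtain h | h := h
        · exact .ax ⟨l, a.unpair.2, by rw [e, h]⟩
        · have h' := ih _ (Nat.lt_succ_of_le (Nat.unpair_right_le a)) h
          exact .step ⟨l, a.unpair.1, a.unpair.2, by rw [e], rfl, rfl⟩ h' h'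
  · intro h
    generalize hx : Nat.pair l a = x at h
    induction h generalizing a with
    | ax h =>
      obtain ⟨l', r, rfl⟩ := h
      obtain ⟨rfl, rfl⟩ := Nat.pair_eq_pair.1 hx
      simp [dl_cons]
    | step h _ _ ih _ =>
      obtain ⟨l', d, r, rfl, rfl, rfl⟩ := h
      obtain ⟨rfl, rfl⟩ := Nat.pair_eq_pair.1 hx
      simp [dl_cons, ih rfl]

/-- The element denoted by the term code `c` under the assignment `a`. -/
def V (c a : ℕ) : ℕ := Nat.pair 0 (Nat.pair c a)
/-- The Henkin witness for the universal quantification of `c` under the assignment `a`. -/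
def Wt (c a : ℕ) : ℕ := Nat.pair 1 (Nat.pair c a)
/-- The successor of an element. -/
def eS (d : ℕ) : ℕ := V (cSucc cHd) (cons d 0)
/-- The sum of two elements. -/
def eAdd (d e : ℕ) : ℕ := V (cAdd cHd (cWk cHd)) (cons d (cons e 0))
/-- The product of two elements. -/
def eMul (d e : ℕ) : ℕ := V (cMul cHd (cWk cHd)) (cons d (cons e 0))
/-- The proposition that the formula coded by `c` holds under the assignment `a`. -/
def pF (c a : ℕ) : ℕ := Nat.pair 0 (Nat.pair c a)
/-- The proposition that two elements are equal. -/
def pE (d e : ℕ) : ℕ := Nat.pair 1 (Nat.pair d e)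
/-- The proposition that two elements are related by `≤`. -/
def pL (d e : ℕ) : ℕ := Nat.pair 2 (Nat.pair d e)
/-- The literal asserting a proposition. -/
def pos (p : ℕ) : ℕ := 2 * p + 1
/-- The literal denying a proposition. -/
def neg (p : ℕ) : ℕ := 2 * p

/-- Triples of literals that cannot hold together. -/
def schemas (t s a d e f : ℕ) : List (ℕ × ℕ × ℕ) :=
  [(pos t, neg t, neg t),
   (neg (pE d d), neg (pE d d), neg (pE d d)),
   (pos (pE d e), pos (pE d e), neg (pE e d)),
   (pos (pE d e), pos (pE e f), neg (pE d f)),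
   (pos (pE d e), pos (pL d f), neg (pL e f)),
   (pos (pE d e), pos (pL f d), neg (pL f e)),
   (neg (pE (V cHd (cons d a)) d), neg (pE (V cHd (cons d a)) d), neg (pE (V cHd (cons d a)) d)),
   (neg (pE (V (cWk t) (cons d a)) (V t a)), neg (pE (V (cWk t) (cons d a)) (V t a)),
     neg (pE (V (cWk t) (cons d a)) (V t a))),
   (neg (pE (V (cNum 0) a) (V (cNum 0) 0)), neg (pE (V (cNum 0) a) (V (cNum 0) 0)),
     neg (pE (V (cNum 0) a) (V (cNum 0) 0))),
   (neg (pE (V (cNum (t + 1)) a) (eS (V (cNum t) a))),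
     neg (pE (V (cNum (t + 1)) a) (eS (V (cNum t) a))),
     neg (pE (V (cNum (t + 1)) a) (eS (V (cNum t) a)))),
   (pos (pE (V t a) d), pos (pE (V t a) d), neg (pE (V (cSucc t) a) (eS d))),
   (pos (pE (V t a) d), pos (pE (V s a) e), neg (pE (V (cAdd t s) a) (eAdd d e))),
   (pos (pE (V t a) d), pos (pE (V s a) e), neg (pE (V (cMul t s) a) (eMul d e))),
   (pos (pF cFls a), pos (pF cFls a), pos (pF cFls a)),
   (pos (pF (cEq t s) a), pos (pF (cEq t s) a), neg (pE (V t a) (V s a))),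
   (neg (pF (cEq t s) a), neg (pF (cEq t s) a), pos (pE (V t a) (V s a))),
   (pos (pF (cLe t s) a), pos (pF (cLe t s) a), neg (pL (V t a) (V s a))),
   (neg (pF (cLe t s) a), neg (pF (cLe t s) a), pos (pL (V t a) (V s a))),
   (pos (pF (cImp t s) a), pos (pF t a), neg (pF s a)),
   (neg (pF (cImp t s) a), neg (pF (cImp t s) a), neg (pF t a)),
   (neg (pF (cImp t s) a), neg (pF (cImp t s) a), pos (pF s a)),
   (pos (pF (cAll t) a), pos (pF (cAll t) a), neg (pF t (cons d a))),
   (neg (pF (cAll t) a), neg (pF (cAll t) a), pos (pF t (cons (Wt t a) a)))]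

/-- Triples of literals that cannot hold together in a model of the sentences coded by `Ax`. -/
def Clause (Ax : ℕ → Prop) (x y z : ℕ) : Prop :=
  (∃ t s a d e f, (x, y, z) ∈ schemas t s a d e f) ∨
    ∃ c, Ax c ∧ x = neg (pF c 0) ∧ y = neg (pF c 0) ∧ z = neg (pF c 0)

/-- The coded list `ρ` of literals contains an excluded triple. -/
def Leaf (Ax : ℕ → Prop) (ρ : ℕ) : Prop :=
  ∃ x y z, Clause Ax x y z ∧ x ∈ dl ρ ∧ y ∈ dl ρ ∧ z ∈ dl ρ

/-- The coded list `ρ` of literals is refutable by a finite tree of case distinctions. -/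
def Ref (Ax : ℕ → Prop) : ℕ → Prop :=
  Der (Leaf Ax) fun ρ y z => ∃ p, y = cons (neg p) ρ ∧ z = cons (pos p) ρ

section Definability
variable {n k : ℕ} {f g : (Fin k → ℕ) → ℕ}

theorem SD.mem_dl (hf : SF n f) (hg : SF n g) : SD n fun v => f v ∈ dl (g v) := by
  refine SD.congr (SP.comp (Der.sp ?_ fun {k f g h} hf hg hh => ?_) (hf.pair hg))
    fun v => mem_dl_iff
  · exact .ex (.ex (.eq (.var 0) (.pair (.var 1) (.cons (.var 1) (.var 2)))))
  · refine .ex (.ex (.ex (.and (.eq hf.init.init.init ?_)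
      (.and (.eq hg.init.init.init ?_) (.eq hh.init.init.init ?_)))))
    · exact .pair (.var (Fin.last k).castSucc.castSucc)
        (.cons (.var (Fin.last _).castSucc) (.var (Fin.last _)))
    · exact .pair (.var (Fin.last k).castSucc.castSucc) (.var (Fin.last _))
    · exact .pair (.var (Fin.last k).castSucc.castSucc) (.var (Fin.last _))

theorem SF.V (hf : SF n f) (hg : SF n g) : SF n fun v => V (f v) (g v) :=
  .pair (.const 0) (.pair hf hg)
theorem SF.Wt (hf : SF n f) (hg : SF n g) : SF n fun v => Wt (f v) (g v) :=
  .pair (.const 1) (.pair hf hg)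
theorem SF.pF (hf : SF n f) (hg : SF n g) : SF n fun v => pF (f v) (g v) :=
  .pair (.const 0) (.pair hf hg)
theorem SF.pE (hf : SF n f) (hg : SF n g) : SF n fun v => pE (f v) (g v) :=
  .pair (.const 1) (.pair hf hg)
theorem SF.pL (hf : SF n f) (hg : SF n g) : SF n fun v => pL (f v) (g v) :=
  .pair (.const 2) (.pair hf hg)
theorem SF.eS (hf : SF n f) : SF n fun v => eS (f v) := .V (.const _) (.cons hf (.const 0))
theorem SF.eAdd (hf : SF n f) (hg : SF n g) : SF n fun v => eAdd (f v) (g v) :=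
  .V (.const _) (.cons hf (.cons hg (.const 0)))
theorem SF.eMul (hf : SF n f) (hg : SF n g) : SF n fun v => eMul (f v) (g v) :=
  .V (.const _) (.cons hf (.cons hg (.const 0)))
theorem SF.pos (hf : SF n f) : SF n fun v => pos (f v) := .add (.mul (.const 2) hf) (.const 1)
theorem SF.neg (hf : SF n f) : SF n fun v => neg (f v) := .mul (.const 2) hf

set_option maxHeartbeats 1000000 in
theorem SD.clause {Ax : ℕ → Prop} (hA : SP n Ax) {h : (Fin k → ℕ) → ℕ} (hf : SF n f) (hg : SF n g)
    (hh : SF n h) : SD n fun v => Clause Ax (f v) (g v) (h v) := by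
  simp only [Clause, schemas, List.mem_cons, Prod.mk.injEq, List.not_mem_nil, or_false]
  refine .or (.ex (.ex (.ex (.ex (.ex (.ex ?_)))))) (.ex (.and (hA.comp (.var (Fin.last k))) ?_))
  · have hf' := hf.init.init.init.init.init.init
    have hg' := hg.init.init.init.init.init.init
    have hh' := hh.init.init.init.init.init.init
    repeat' with_reducible first
      | exact SF.const _ | exact hf' | exact hg' | exact hh'
      | apply SD.or | apply SD.and | apply SD.eq | apply SF.pos | apply SF.neg | apply SF.pF
      | apply SF.pE | apply SF.pL | apply SF.V | apply SF.Wt | apply SF.eS | apply SF.eAdd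
      | apply SF.eMul | apply SF.cons | apply SF.cNum | apply SF.cWk | apply SF.cSucc
      | apply SF.cAdd | apply SF.cMul | apply SF.cEq | apply SF.cLe | apply SF.cImp
      | apply SF.cAll | apply SF.add
    all_goals exact SF.var _
  · have hx : SF n fun v : Fin (k + 1) → ℕ => GRNonRE.neg (GRNonRE.pF (v (Fin.last k)) 0) :=
      .neg (.pF (.var _) (.const 0))
    exact .and (.eq hf.init hx) (.and (.eq hg.init hx) (.eq hh.init hx))

theorem ref_sp {Ax : ℕ → Prop} (hA : SP n Ax) : SP n (Ref Ax) := by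
  refine Der.sp ?_ fun {k f g h} hf hg hh => ?_
  · exact .ex (.ex (.ex (.and (.clause hA (.var 1) (.var 2) (.var 3)) (.and (.mem_dl (.var 1) (.var 0))
      (.and (.mem_dl (.var 2) (.var 0)) (.mem_dl (.var 3) (.var 0)))))))
  · exact .ex (.and (.eq hg.init (.cons (.neg (.var (Fin.last k))) hf.init))
      (.eq hh.init (.cons (.pos (.var (Fin.last k))) hf.init)))

end Definability

/-- The literal `l` holds under the valuation `v`. -/
def Holds (v : ℕ → Prop) (l : ℕ) : Prop := (l % 2 = 1 ∧ v (l / 2)) ∨ (l % 2 = 0 ∧ ¬ v (l / 2))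

theorem holds_pos {v : ℕ → Prop} {p : ℕ} : Holds v (pos p) ↔ v p := by
  have h₁ : (2 * p + 1) % 2 = 1 := by omega
  have h₂ : (2 * p + 1) / 2 = p := by omega
  simp [Holds, pos, h₁, h₂]

theorem holds_neg {v : ℕ → Prop} {p : ℕ} : Holds v (neg p) ↔ ¬ v p := by
  simp [Holds, neg]

theorem eq_pos_or_neg (l : ℕ) : ∃ p, l = pos p ∨ l = neg p :=
  ⟨l / 2, by unfold pos neg; omega⟩

/-- Valuations describing a model, with Henkin witnesses, of the sentences coded by `Ax`. -/
structure Good (Ax : ℕ → Prop) (v : ℕ → Prop) : Prop where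
  refl (d : ℕ) : v (pE d d)
  symm {d e : ℕ} : v (pE d e) → v (pE e d)
  trans {d e f : ℕ} : v (pE d e) → v (pE e f) → v (pE d f)
  le_left {d e f : ℕ} : v (pE d e) → v (pL d f) → v (pL e f)
  le_right {d e f : ℕ} : v (pE d e) → v (pL f d) → v (pL f e)
  hd (d a : ℕ) : v (pE (V cHd (cons d a)) d)
  wk (t d a : ℕ) : v (pE (V (cWk t) (cons d a)) (V t a))
  num_zero (a : ℕ) : v (pE (V (cNum 0) a) (V (cNum 0) 0))
  num_succ (m a : ℕ) : v (pE (V (cNum (m + 1)) a) (eS (V (cNum m) a)))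
  succ {t a d : ℕ} : v (pE (V t a) d) → v (pE (V (cSucc t) a) (eS d))
  add {t s a d e : ℕ} : v (pE (V t a) d) → v (pE (V s a) e) → v (pE (V (cAdd t s) a) (eAdd d e))
  mul {t s a d e : ℕ} : v (pE (V t a) d) → v (pE (V s a) e) → v (pE (V (cMul t s) a) (eMul d e))
  fls (a : ℕ) : ¬ v (pF cFls a)
  eq {t s a : ℕ} : v (pF (cEq t s) a) ↔ v (pE (V t a) (V s a))
  le {t s a : ℕ} : v (pF (cLe t s) a) ↔ v (pL (V t a) (V s a))
  imp {t s a : ℕ} : v (pF (cImp t s) a) ↔ (v (pF t a) → v (pF s a))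
  all {t a : ℕ} (d : ℕ) : v (pF (cAll t) a) → v (pF t (cons d a))
  wit {t a : ℕ} : v (pF t (cons (Wt t a) a)) → v (pF (cAll t) a)
  ax {c : ℕ} : Ax c → v (pF c 0)

theorem good_iff {Ax v : ℕ → Prop} :
    Good Ax v ↔ ∀ x y z, Clause Ax x y z → ¬ (Holds v x ∧ Holds v y ∧ Holds v z) := by
  constructor
  · rintro h x y z (⟨t, s, a, d, e, f, hx⟩ | ⟨c, hc, rfl, rfl, rfl⟩)
    · revert x y z
      have H : ∀ q ∈ schemas t s a d e f, ¬ (Holds v q.1 ∧ Holds v q.2.1 ∧ Holds v q.2.2) := by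
        simp only [schemas, List.forall_mem_cons, holds_pos, holds_neg, h.refl, h.hd, h.wk,
          h.num_zero, h.num_succ, h.fls, h.eq, h.le, h.imp]
        have h₁ := @h.symm d e
        have h₂ := @h.trans d e f
        have h₃ := @h.le_left d e f
        have h₄ := @h.le_right d e f
        have h₅ := @h.succ t a d
        have h₆ := @h.add t s a d e
        have h₇ := @h.mul t s a d e
        have h₈ := @h.all t a d
        have h₉ := @h.wit t a
        simp only [List.not_mem_nil, false_imp_iff, implies_true]
        clear h
        and_intros
        all_goals grind
      exact fun x y z hx => H _ hx
    · simp [holds_neg, h.ax hc]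
  · intro H
    have H' (t s a d e f : ℕ) :
        ∀ q ∈ schemas t s a d e f, ¬ (Holds v q.1 ∧ Holds v q.2.1 ∧ Holds v q.2.2) :=
      fun q hq => H _ _ _ (.inl ⟨t, s, a, d, e, f, hq⟩)
    simp only [schemas, List.forall_mem_cons, holds_pos, holds_neg, List.not_mem_nil,
      false_imp_iff, implies_true, and_true, forall_and] at H'
    obtain ⟨_, h₁, h₂, h₃, h₄, h₅, h₆, h₇, h₈, h₉, h₁₀, h₁₁, h₁₂, h₁₃, h₁₄, h₁₅, h₁₆, h₁₇, h₁₈, h₁₉,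
      h₂₀, h₂₁, h₂₂⟩ := H'
    refine ⟨?_, ?_, ?_, ?_, ?_, ?_, ?_, ?_, ?_, ?_, ?_, ?_, ?_, ?_, ?_, ?_, ?_, ?_, ?_⟩
    · intro d
      have k₁ := h₁ 0 0 0 d 0 0
      grind
    · intro d e
      have k₁ := h₂ 0 0 0 d e 0
      grind
    · intro d e f
      have k₁ := h₃ 0 0 0 d e f
      grind
    · intro d e f
      have k₁ := h₄ 0 0 0 d e f
      grind
    · intro d e f
      have k₁ := h₅ 0 0 0 d e f
      grind
    · intro d a
      have k₁ := h₆ 0 0 a d 0 0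
      grind
    · intro t d a
      have k₁ := h₇ t 0 a d 0 0
      grind
    · intro a
      have k₁ := h₈ 0 0 a 0 0 0
      grind
    · intro m a
      have k₁ := h₉ m 0 a 0 0 0
      grind
    · intro t a d
      have k₁ := h₁₀ t 0 a d 0 0
      grind
    · intro t s a d e
      have k₁ := h₁₁ t s a d e 0
      grind
    · intro t s a d e
      have k₁ := h₁₂ t s a d e 0
      grind
    · intro a
      have k₁ := h₁₃ 0 0 a 0 0 0
      grind
    · intro t s a
      have k₁ := h₁₄ t s a 0 0 0
      have k₂ := h₁₅ t s a 0 0 0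
      grind
    · intro t s a
      have k₁ := h₁₆ t s a 0 0 0
      have k₂ := h₁₇ t s a 0 0 0
      grind
    · intro t s a
      have k₁ := h₁₈ t s a 0 0 0
      have k₂ := h₁₉ t s a 0 0 0
      have k₃ := h₂₀ t s a 0 0 0
      grind
    · intro t a d
      have k₁ := h₂₁ t 0 a d 0 0
      grind
    · intro t a
      have k₁ := h₂₂ t 0 a 0 0 0
      grind
    · intro c hc
      have := H _ _ _ (.inr ⟨c, hc, rfl, rfl, rfl⟩)
      simpa [holds_neg] using this

theorem Ref.sound {Ax v : ℕ → Prop} {ρ : ℕ} (h : Ref Ax ρ) (hv : Good Ax v) :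
    ¬ ∀ l ∈ dl ρ, Holds v l := by
  induction h with
  | ax h =>
    obtain ⟨x, y, z, h, hx, hy, hz⟩ := h
    exact fun H => good_iff.1 hv x y z h ⟨H x hx, H y hy, H z hz⟩
  | step h _ _ ih₁ ih₂ =>
    obtain ⟨p, rfl, rfl⟩ := h
    simp only [dl_cons, List.forall_mem_cons, holds_pos, holds_neg] at ih₁ ih₂
    tauto

open Classical in
/-- Greedy extension of `ρ` to an irrefutable list of literals. -/
noncomputable def extend (Ax : ℕ → Prop) (ρ : ℕ) : ℕ → ℕ
  | 0 => ρ
  | p + 1 => if Ref Ax (cons (pos p) (extend Ax ρ p)) then cons (neg p) (extend Ax ρ p)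
      else cons (pos p) (extend Ax ρ p)

open Classical in
theorem Ref.complete {Ax : ℕ → Prop} {ρ : ℕ} (h : ¬ Ref Ax ρ) :
    ∃ v, Good Ax v ∧ ∀ l ∈ dl ρ, Holds v l := by
  have hR (p : ℕ) : ¬ Ref Ax (extend Ax ρ p) := by
    induction p with
    | zero => exact h
    | succ p ih =>
      rw [extend]
      split_ifs with h₁
      · exact fun h₂ => ih (.step ⟨p, rfl, rfl⟩ h₂ h₁)
      · exact h₁
  have hmono {p q : ℕ} (hpq : p ≤ q) {l : ℕ} (hl : l ∈ dl (extend Ax ρ p)) :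
      l ∈ dl (extend Ax ρ q) := by
    induction q, hpq using Nat.le_induction with
    | base => exact hl
    | succ q _ ih =>
      rw [extend]
      split_ifs <;> rw [dl_cons] <;> exact List.mem_cons_of_mem _ ih
  have hcl {x y z p q r : ℕ} (hx : x ∈ dl (extend Ax ρ p)) (hy : y ∈ dl (extend Ax ρ q))
      (hz : z ∈ dl (extend Ax ρ r)) : ¬ Clause Ax x y z := fun hc =>
    hR (p + q + r) (.ax ⟨x, y, z, hc, hmono (by omega) hx, hmono (by omega) hy,
      hmono (by omega) hz⟩)
  let v (p : ℕ) : Prop := ¬ Ref Ax (cons (pos p) (extend Ax ρ p))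
  have hin (p : ℕ) : if v p then pos p ∈ dl (extend Ax ρ (p + 1)) else
      neg p ∈ dl (extend Ax ρ (p + 1)) := by
    rw [extend]
    by_cases hp : Ref Ax (cons (pos p) (extend Ax ρ p)) <;> simp [v, hp, dl_cons]
  have hmem {l : ℕ} (hl : Holds v l) : ∃ q, l ∈ dl (extend Ax ρ q) := by
    obtain ⟨p, rfl | rfl⟩ := eq_pos_or_neg l
    · have := hin p
      rw [if_pos (holds_pos.1 hl)] at this
      exact ⟨_, this⟩
    · have := hin p
      rw [if_neg (holds_neg.1 hl)] at this
      exact ⟨_, this⟩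
  have hne {p q r : ℕ} (h₁ : pos p ∈ dl (extend Ax ρ q)) : neg p ∉ dl (extend Ax ρ r) := fun h₂ =>
    hcl h₁ h₂ h₂ (.inl ⟨p, 0, 0, 0, 0, 0, by simp [schemas]⟩)
  refine ⟨v, good_iff.2 fun x y z hc ⟨hx, hy, hz⟩ => ?_, fun l hl => ?_⟩
  · obtain ⟨p, hp⟩ := hmem hx
    obtain ⟨q, hq⟩ := hmem hy
    obtain ⟨r, hr⟩ := hmem hz
    exact hcl hp hq hr hc
  · have hl' : l ∈ dl (extend Ax ρ 0) := hl
    obtain ⟨p, rfl | rfl⟩ := eq_pos_or_neg l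
    · rw [holds_pos]
      refine Classical.not_not.1 fun hv => ?_
      have := hin p
      rw [if_neg hv] at this
      exact hne hl' this
    · rw [holds_neg]
      intro hv
      have := hin p
      rw [if_pos hv] at this
      exact hne this hl'

/-! ### Soundness of the refutation system -/

/-- The entries of a tuple, last one first. -/
def toL {α : Type} : ∀ {k : ℕ}, (Fin k → α) → List α
  | 0, _ => []
  | k + 1, xs => xs (Fin.last k) :: toL (Fin.init xs)

theorem toL_snoc {α : Type} {k : ℕ} (xs : Fin k → α) (x : α) :
    toL (Fin.snoc xs x : Fin (k + 1) → α) = x :: toL xs := by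
  simp [toL]

section Model
variable (M : Type) [LA.Structure M]

/-- The interpretation of `0`. -/
def mZero : M := Structure.funMap (L := LA) ArithFunc.zero ![]

variable {M}

/-- The interpretation of `S`. -/
def mSucc (x : M) : M := Structure.funMap (L := LA) ArithFunc.succ ![x]
/-- The interpretation of `+`. -/
def mAdd (x y : M) : M := Structure.funMap (L := LA) ArithFunc.add ![x, y]
/-- The interpretation of `×`. -/
def mMul (x y : M) : M := Structure.funMap (L := LA) ArithFunc.mul ![x, y]
/-- The interpretation of `≤`. -/
def mLe (x y : M) : Prop := Structure.RelMap (L := LA) ArithRel.le ![x, y]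

theorem realize_zeroT' {α : Type} (v : α → M) : (zeroT : LA.Term α).realize v = mZero M :=
  congrArg (Structure.funMap (L := LA) ArithFunc.zero) (Subsingleton.elim _ _)

theorem realize_succT' {α : Type} (v : α → M) (t : LA.Term α) :
    (succT t).realize v = mSucc (t.realize v) :=
  congrArg (Structure.funMap (L := LA) ArithFunc.succ) (by ext i; fin_cases i; rfl)

theorem realize_addT' {α : Type} (v : α → M) (t s : LA.Term α) :
    (addT t s).realize v = mAdd (t.realize v) (s.realize v) :=
  congrArg (Structure.funMap (L := LA) ArithFunc.add) (by ext i; fin_cases i <;> rfl)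

theorem realize_mulT' {α : Type} (v : α → M) (t s : LA.Term α) :
    (mulT t s).realize v = mMul (t.realize v) (s.realize v) :=
  congrArg (Structure.funMap (L := LA) ArithFunc.mul) (by ext i; fin_cases i <;> rfl)

theorem realize_leF' {α : Type} {k : ℕ} (v : α → M) (xs : Fin k → M)
    (t s : LA.Term (α ⊕ Fin k)) : (leF t s).Realize v xs ↔
      mLe (t.realize (Sum.elim v xs)) (s.realize (Sum.elim v xs)) :=
  iff_of_eq (congrArg (Structure.RelMap (L := LA) ArithRel.le) (by ext i; fin_cases i <;> rfl))

/-- The value of a coded term. -/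
def rv : ℕ → List M → M
  | 0, _ => mZero M
  | n + 1, l => match n.unpair.1 with
    | 0 => l.headD (mZero M)
    | 1 => mSucc^[n.unpair.2] (mZero M)
    | 2 => rv n.unpair.2 l.tail
    | 3 => mSucc (rv n.unpair.2 l)
    | 4 => mAdd (rv n.unpair.2.unpair.1 l) (rv n.unpair.2.unpair.2 l)
    | 5 => mMul (rv n.unpair.2.unpair.1 l) (rv n.unpair.2.unpair.2 l)
    | _ => mZero M
termination_by n => n
decreasing_by
  all_goals
    have := Nat.unpair_right_le n
    have := Nat.unpair_left_le n.unpair.2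
    have := Nat.unpair_right_le n.unpair.2
    omega

/-- The truth value of a coded formula. -/
def sat : ℕ → List M → Prop
  | 0, _ => False
  | n + 1, l => match n.unpair.1 with
    | 7 => rv n.unpair.2.unpair.1 l = rv n.unpair.2.unpair.2 l
    | 8 => mLe (rv n.unpair.2.unpair.1 l) (rv n.unpair.2.unpair.2 l)
    | 9 => sat n.unpair.2.unpair.1 l → sat n.unpair.2.unpair.2 l
    | 10 => ∀ x : M, sat n.unpair.2 (x :: l)
    | _ => False
termination_by n => n
decreasing_by
  all_goals
    have := Nat.unpair_right_le n
    have := Nat.unpair_left_le n.unpair.2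
    have := Nat.unpair_right_le n.unpair.2
    omega

theorem rv_hd (l : List M) : rv cHd l = l.headD (mZero M) := by simp [cHd, node, rv]
theorem rv_num (m : ℕ) (l : List M) : rv (cNum m) l = mSucc^[m] (mZero M) := by
  simp [cNum, node, rv]
theorem rv_wk (t : ℕ) (l : List M) : rv (cWk t) l = rv t l.tail := by simp [cWk, node, rv]
theorem rv_succ (t : ℕ) (l : List M) : rv (cSucc t) l = mSucc (rv t l) := by
  simp [cSucc, node, rv]
theorem rv_add (t s : ℕ) (l : List M) : rv (cAdd t s) l = mAdd (rv t l) (rv s l) := by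
  simp [cAdd, node, rv]
theorem rv_mul (t s : ℕ) (l : List M) : rv (cMul t s) l = mMul (rv t l) (rv s l) := by
  simp [cMul, node, rv]
theorem sat_fls (l : List M) : ¬ sat cFls l := by simp [cFls, node, sat]
theorem sat_eq (t s : ℕ) (l : List M) : sat (cEq t s) l ↔ rv t l = rv s l := by
  simp [cEq, node, sat]
theorem sat_le (t s : ℕ) (l : List M) : sat (cLe t s) l ↔ mLe (rv t l) (rv s l) := by
  simp [cLe, node, sat]
theorem sat_imp (t s : ℕ) (l : List M) : sat (cImp t s) l ↔ (sat t l → sat s l) := by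
  simp [cImp, node, sat]
theorem sat_all (t : ℕ) (l : List M) : sat (cAll t) l ↔ ∀ x : M, sat t (x :: l) := by
  simp [cAll, node, sat]

theorem realize_liftT_init {k : ℕ} (t : LA.Term (Empty ⊕ Fin k)) (w : Empty → M)
    (v : Fin (k + 1) → M) :
    (liftT t).realize (Sum.elim w v) = t.realize (Sum.elim w (Fin.init v)) := by
  conv_lhs => rw [← Fin.snoc_init_self v]
  exact realize_liftT ..

theorem TC.rv_eq {c k : ℕ} {t : LA.Term (Empty ⊕ Fin k)} (h : TC c k t) (xs : Fin k → M) :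
    rv c (toL xs) = t.realize (Sum.elim default xs) := by
  induction h with
  | hd k => simp [rv_hd, toL]
  | wk _ ih => rw [rv_wk, toL, List.tail_cons, ih, realize_liftT_init]
  | zero k => rw [rv_num, realize_zeroT']; rfl
  | succ _ ih => rw [rv_succ, ih, realize_succT']
  | add _ _ ih₁ ih₂ => rw [rv_add, ih₁, ih₂, realize_addT']
  | mul _ _ ih₁ ih₂ => rw [rv_mul, ih₁, ih₂, realize_mulT']

theorem FC.sat_iff {c k : ℕ} {φ : LA.BoundedFormula Empty k} (h : FC c k φ) (xs : Fin k → M) :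
    sat c (toL xs) ↔ φ.Realize default xs := by
  induction h with
  | fls k => simp [sat_fls]
  | eq h₁ h₂ => rw [sat_eq, h₁.rv_eq, h₂.rv_eq, realize_bdEqual]
  | le h₁ h₂ => rw [sat_le, h₁.rv_eq, h₂.rv_eq, realize_leF']
  | imp _ _ ih₁ ih₂ => rw [sat_imp, ih₁, ih₂, realize_imp]
  | all _ ih =>
    rw [sat_all, realize_all]
    exact forall_congr' fun x => by rw [← toL_snoc, ih]

/-- A counterexample to the universal quantification of the formula coded by `c`, if any. -/
noncomputable def counterex (c : ℕ) (l : List M) : M :=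
  @Classical.epsilon M ⟨mZero M⟩ fun y => ¬ sat c (y :: l)

theorem sat_of_counterex {c : ℕ} {l : List M} (h : sat c (counterex c l :: l)) (y : M) :
    sat c (y :: l) := by
  by_contra hy
  exact @Classical.epsilon_spec M (fun y => ¬ sat c (y :: l)) ⟨y, hy⟩ h

/-- The interpretation of elements. -/
noncomputable def el (x : ℕ) : M :=
  let l : List M := (dl x.unpair.2.unpair.2).attach.map fun y => el y.1
  if x.unpair.1 = 0 then rv x.unpair.2.unpair.1 l
  else counterex x.unpair.2.unpair.1 l
termination_by x
decreasing_by
  all_goals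
    have := lt_of_mem_dl y.2
    have := Nat.unpair_right_le x
    have := Nat.unpair_right_le x.unpair.2
    omega

theorem el_V (c a : ℕ) : (el (V c a) : M) = rv c ((dl a).map el) := by
  rw [el]
  simp [V]

theorem el_Wt (c a : ℕ) : (el (Wt c a) : M) = counterex c ((dl a).map el) := by
  rw [el]
  simp [Wt]

variable (M) in
/-- The valuation given by a model. -/
def tv (p : ℕ) : Prop := match p.unpair.1 with
  | 0 => sat p.unpair.2.unpair.1 ((dl p.unpair.2.unpair.2).map (el : ℕ → M))
  | 1 => (el p.unpair.2.unpair.1 : M) = el p.unpair.2.unpair.2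
  | _ => mLe (el p.unpair.2.unpair.1 : M) (el p.unpair.2.unpair.2)

theorem tv_pF {c a : ℕ} : tv M (pF c a) ↔ sat c ((dl a).map (el : ℕ → M)) := by simp [tv, pF]
theorem tv_pE {d e : ℕ} : tv M (pE d e) ↔ (el d : M) = el e := by simp [tv, pE]
theorem tv_pL {d e : ℕ} : tv M (pL d e) ↔ mLe (el d : M) (el e) := by simp [tv, pL]

theorem el_eS (d : ℕ) : (el (eS d) : M) = mSucc (el d) := by
  simp [eS, el_V, rv_succ, rv_hd, dl_cons]
theorem el_eAdd (d e : ℕ) : (el (eAdd d e) : M) = mAdd (el d) (el e) := by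
  simp [eAdd, el_V, rv_add, rv_wk, rv_hd, dl_cons]
theorem el_eMul (d e : ℕ) : (el (eMul d e) : M) = mMul (el d) (el e) := by
  simp [eMul, el_V, rv_mul, rv_wk, rv_hd, dl_cons]

theorem good_tv {Ax : ℕ → Prop} (hA : ∀ c, Ax c → sat c ([] : List M)) : Good Ax (tv M) where
  refl d := by simp [tv_pE]
  symm := by simp only [tv_pE]; exact Eq.symm
  trans := by simp only [tv_pE]; exact Eq.trans
  le_left := by simp only [tv_pE, tv_pL]; intro d e f h; simp [h]
  le_right := by simp only [tv_pE, tv_pL]; intro d e f h; simp [h]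
  hd d a := by simp [tv_pE, el_V, rv_hd, dl_cons]
  wk t d a := by simp [tv_pE, el_V, rv_wk, dl_cons]
  num_zero a := by simp [tv_pE, el_V, rv_num]
  num_succ m a := by simp only [tv_pE, el_eS, el_V, rv_num, Function.iterate_succ_apply']
  succ h := by
    simp only [tv_pE, el_eS, el_V, rv_succ] at h ⊢
    rw [h]
  add h₁ h₂ := by
    simp only [tv_pE, el_eAdd, el_V, rv_add] at h₁ h₂ ⊢
    rw [h₁, h₂]
  mul h₁ h₂ := by
    simp only [tv_pE, el_eMul, el_V, rv_mul] at h₁ h₂ ⊢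
    rw [h₁, h₂]
  fls a := by simp [tv_pF, sat_fls]
  eq := by simp [tv_pF, tv_pE, el_V, sat_eq]
  le := by simp [tv_pF, tv_pL, el_V, sat_le]
  imp := by simp [tv_pF, sat_imp]
  all d h := by
    simp only [tv_pF, sat_all, dl_cons, List.map_cons] at h ⊢
    exact h _
  wit h := by
    simp only [tv_pF, sat_all, dl_cons, List.map_cons, el_Wt] at h ⊢
    exact sat_of_counterex h
  ax h := by simpa [tv_pF, dl_zero] using hA _ h

end Model

/-! ### Completeness of the refutation system -/

/-- Code of a tuple of elements, last one first. -/
def tl {k : ℕ} (xs : Fin k → ℕ) : ℕ := (toL xs).foldr cons 0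

theorem tl_snoc {k : ℕ} (xs : Fin k → ℕ) (x : ℕ) :
    tl (Fin.snoc xs x : Fin (k + 1) → ℕ) = cons x (tl xs) := by
  rw [tl, toL_snoc]
  rfl

section Henkin
variable {Ax v : ℕ → Prop} (hv : Good Ax v)

/-- Equality of elements according to a valuation. -/
def henkinSetoid : Setoid ℕ where
  r d e := v (pE d e)
  iseqv := ⟨hv.refl, hv.symm, hv.trans⟩

/-- The model described by a valuation. -/
def Henkin : Type := Quotient (henkinSetoid hv)

/-- The interpretation of an element in the model described by a valuation. -/
def mk (d : ℕ) : Henkin hv := Quotient.mk (henkinSetoid hv) d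

theorem mk_eq_mk {d e : ℕ} : mk hv d = mk hv e ↔ v (pE d e) :=
  Quotient.eq (r := henkinSetoid hv)

instance : LA.Structure (Henkin hv) where
  funMap {_} f := match f with
    | ArithFunc.zero => fun _ => mk hv (V (cNum 0) 0)
    | ArithFunc.succ => fun xs => Quotient.lift (s := henkinSetoid hv) (fun d => mk hv (eS d))
        (fun _ _ h => (mk_eq_mk hv).2 (hv.succ (hv.trans (hv.hd _ 0) h))) (xs 0)
    | ArithFunc.add => fun xs => Quotient.lift₂ (s₁ := henkinSetoid hv) (s₂ := henkinSetoid hv)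
        (fun d e => mk hv (eAdd d e)) (fun _ _ _ _ h₁ h₂ => (mk_eq_mk hv).2
          (hv.add (hv.trans (hv.hd _ _) h₁) (hv.trans (hv.wk _ _ _) (hv.trans (hv.hd _ _) h₂))))
        (xs 0) (xs 1)
    | ArithFunc.mul => fun xs => Quotient.lift₂ (s₁ := henkinSetoid hv) (s₂ := henkinSetoid hv)
        (fun d e => mk hv (eMul d e)) (fun _ _ _ _ h₁ h₂ => (mk_eq_mk hv).2
          (hv.mul (hv.trans (hv.hd _ _) h₁) (hv.trans (hv.wk _ _ _) (hv.trans (hv.hd _ _) h₂))))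
        (xs 0) (xs 1)
  RelMap {_} r := match r with
    | ArithRel.le => fun xs => Quotient.lift₂ (s₁ := henkinSetoid hv) (s₂ := henkinSetoid hv)
        (fun d e => v (pL d e)) (fun _ _ _ _ h₁ h₂ => propext
          ⟨fun h => hv.le_left h₁ (hv.le_right h₂ h),
            fun h => hv.le_left (hv.symm h₁) (hv.le_right (hv.symm h₂) h)⟩) (xs 0) (xs 1)

theorem mk_eS (d : ℕ) : mk hv (eS d) = mSucc (mk hv d) := rfl
theorem mk_eAdd (d e : ℕ) : mk hv (eAdd d e) = mAdd (mk hv d) (mk hv e) := rfl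
theorem mk_eMul (d e : ℕ) : mk hv (eMul d e) = mMul (mk hv d) (mk hv e) := rfl
theorem mLe_mk {d e : ℕ} : mLe (mk hv d) (mk hv e) ↔ v (pL d e) := Iff.rfl

theorem TC.mk_V {c k : ℕ} {t : LA.Term (Empty ⊕ Fin k)} (h : TC c k t) (xs : Fin k → ℕ) :
    mk hv (V c (tl xs)) = t.realize (Sum.elim default (mk hv ∘ xs)) := by
  induction h with
  | hd k => exact (mk_eq_mk hv).2 (hv.hd _ _)
  | wk _ ih =>
    rw [realize_liftT_init]
    exact ((mk_eq_mk hv).2 (hv.wk _ _ _)).trans (ih _)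
  | zero k =>
    rw [realize_zeroT']
    exact (mk_eq_mk hv).2 (hv.num_zero _)
  | succ _ ih =>
    rw [realize_succT', ← ih, ← mk_eS, mk_eq_mk]
    exact hv.succ (hv.refl _)
  | add _ _ ih₁ ih₂ =>
    rw [realize_addT', ← ih₁, ← ih₂, ← mk_eAdd, mk_eq_mk]
    exact hv.add (hv.refl _) (hv.refl _)
  | mul _ _ ih₁ ih₂ =>
    rw [realize_mulT', ← ih₁, ← ih₂, ← mk_eMul, mk_eq_mk]
    exact hv.mul (hv.refl _) (hv.refl _)

theorem FC.pF_iff {c k : ℕ} {φ : LA.BoundedFormula Empty k} (h : FC c k φ) (xs : Fin k → ℕ) :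
    v (pF c (tl xs)) ↔ φ.Realize default (mk hv ∘ xs) := by
  induction h with
  | fls k => simp [hv.fls]
  | eq h₁ h₂ => rw [hv.eq, realize_bdEqual, ← h₁.mk_V, ← h₂.mk_V, mk_eq_mk]
  | le h₁ h₂ => rw [hv.le, realize_leF', ← h₁.mk_V, ← h₂.mk_V, mLe_mk]
  | imp _ _ ih₁ ih₂ => rw [hv.imp, ih₁, ih₂, realize_imp]
  | all _ ih =>
    have key (x : ℕ) := ih (Fin.snoc xs x)
    simp only [tl_snoc, Fin.comp_snoc] at key
    rw [realize_all]
    constructor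
    · intro h x
      induction x using Quotient.inductionOn with
      | _ x => exact (key x).1 (hv.all x h)
    · exact fun h => hv.wit ((key _).2 (h _))

theorem mk_num (m : ℕ) : mk hv (V (cNum m) 0) = mSucc^[m] (mZero (Henkin hv)) := by
  induction m with
  | zero => rfl
  | succ m ih =>
    rw [Function.iterate_succ_apply', ← ih, ← mk_eS, mk_eq_mk]
    exact hv.num_succ _ _

end Henkin

theorem realize_numeral {M : Type} [LA.Structure M] (w : Empty → M) (m : ℕ) :
    (numeral m).realize w = mSucc^[m] (mZero M) := by
  induction m with
  | zero => exact realize_zeroT' w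
  | succ m ih => rw [numeral, realize_succT', ih, Function.iterate_succ_apply']

/-- A sentence expressing `θ(m̄)`, of the same class as `θ`. -/
def instNum (θ : LA.BoundedFormula Empty 1) (m : ℕ) : LA.Sentence :=
  (∼((&0 : LA.Term (Empty ⊕ Fin 1)) =' (numeral m).relabel Sum.inl) ⊔ θ).all

theorem IsPi.instNum {n : ℕ} {θ : LA.BoundedFormula Empty 1} (h : IsPi (n + 1) θ) (m : ℕ) :
    IsPi (n + 1) (instNum θ m) :=
  .all (.sup (((Delta0.equal _ _).imp .falsum).isSigma_and_isPi _).2 h)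

theorem realize_instNum {M : Type} [LA.Structure M] (θ : LA.BoundedFormula Empty 1) (m : ℕ) :
    M ⊨ instNum θ m ↔ θ.Realize default ![mSucc^[m] (mZero M)] := by
  have e (x : M) : (Fin.snoc default x : Fin 1 → M) = ![x] := by ext i; fin_cases i; rfl
  rw [Sentence.Realize, Formula.Realize, instNum, realize_all]
  simp only [realize_sup, realize_not, realize_bdEqual, e, Term.realize_relabel, Sum.elim_comp_inl,
    realize_numeral]
  constructor
  · intro h
    simpa using h (mSucc^[m] (mZero M))
  · intro h x
    by_cases hx : x = mSucc^[m] (mZero M)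
    · rw [hx]; exact .inr h
    · exact .inl (by simpa using hx)

theorem ref_iff_proves {T : LA.Theory} {Ax : ℕ → Prop} (hA : ∀ c, Ax c ↔ ∃ φ ∈ T, FC c 0 φ)
    {c : ℕ} {θ : LA.BoundedFormula Empty 1} (h : FC c 1 θ) (m : ℕ) :
    Ref Ax (cons (neg (pF c (cons (V (cNum m) 0) 0))) 0) ↔ Proves T (instNum θ m) := by
  constructor
  · intro hR
    refine Theory.models_sentence_iff.2 fun M => ?_
    have hg : Good Ax (tv M) := good_tv fun c hc => by
      obtain ⟨φ, hφ, hc⟩ := (hA c).1 hc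
      exact (hc.sat_iff (default : Fin 0 → M)).2 (Theory.realize_sentence_of_mem T hφ)
    have := hR.sound hg
    simp only [dl_cons, dl_zero, List.forall_mem_cons, holds_neg, tv_pF, List.map_cons, el_V,
      rv_num, List.map_nil, List.not_mem_nil, false_imp_iff, implies_true, and_true,
      Classical.not_not] at this
    rw [realize_instNum, ← h.sat_iff]
    exact this
  · intro hP
    by_contra hR
    obtain ⟨v, hv, hl⟩ := Ref.complete hR
    simp only [dl_cons, dl_zero, List.forall_mem_cons, holds_neg, List.not_mem_nil, false_imp_iff,
      implies_true, and_true] at hl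
    have hT : Henkin hv ⊨ T := by
      refine ⟨fun φ hφ => ?_⟩
      obtain ⟨c, hc⟩ := exists_fc φ
      have := (hc.pF_iff hv default).1 (hv.ax ((hA c).2 ⟨φ, hφ, hc⟩))
      rwa [Subsingleton.elim (mk hv ∘ default) default] at this
    have : Nonempty (Henkin hv) := ⟨mk hv 0⟩
    have hM := Theory.models_sentence_iff.1 hP (Theory.ModelType.of T (Henkin hv))
    refine hl ((h.pF_iff hv ![V (cNum m) 0]).2 ?_)
    rw [show mk hv ∘ ![V (cNum m) 0] = ![mk hv (V (cNum m) 0)] by ext i; fin_cases i; rfl, mk_num]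
    exact (realize_instNum θ m).1 hM

/-! ### The incompleteness theorem -/

theorem iterate_mSucc_nat (m : ℕ) : (mSucc : ℕ → ℕ)^[m] (mZero ℕ) = m := by
  induction m with
  | zero => rfl
  | succ m ih => rw [Function.iterate_succ_apply', ih]; rfl

theorem realize_subst1_nat (P : LA.BoundedFormula Empty 1) (m : ℕ) :
    ℕ ⊨ subst1 P m ↔ P.Realize default ![m] := by
  rw [Sentence.Realize, subst1, Formula.Realize, realize_subst]
  simp only [realize_numeral, iterate_mSucc_nat]
  refine (realize_toFormula P fun _ => m).trans ?_
  rw [Subsingleton.elim (_ ∘ Sum.inl) default]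
  exact iff_of_eq (congrArg _ (by ext i; fin_cases i; rfl))

/-- Provability in `T` of the instances of formulas at their own Gödel numbers is definable. -/
theorem exists_sd_diagonal {n : ℕ} {T : LA.Theory} (h : SigmaDefinable (n + 1) (axiomCodes T)) :
    ∃ D : ℕ → Prop, SP n D ∧ ∀ θ : LA.BoundedFormula Empty 1,
      D (godel θ) ↔ Proves T (instNum θ (godel θ)) := by
  obtain ⟨Ψ, hΨ, hdef⟩ := h
  have hax : SP n (· ∈ axiomCodes T) := by
    refine SD.congr hΨ.defBy.1 fun v => ?_
    change v 0 ∈ axiomCodes T ↔ _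
    rw [hdef, Subsingleton.elim (fun e : Empty => e.elim) default]
    exact iff_of_eq (congrArg _ (by ext i; fin_cases i; rfl))
  let Ax (c : ℕ) : Prop := ∃ m, m ∈ axiomCodes T ∧ FEnc c 0 m
  have hAx : SP n Ax := .ex (.and (hax.comp (.var 1)) (.fEnc (.var 0) (.const 0) (.var 1)))
  have hA (c : ℕ) : Ax c ↔ ∃ φ ∈ T, FC c 0 φ := by
    constructor
    · rintro ⟨_, ⟨φ, hφ, rfl⟩, hc⟩
      exact ⟨φ, hφ, fEnc_godel_iff.1 hc⟩
    · rintro ⟨φ, hφ, hc⟩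
      exact ⟨_, ⟨φ, hφ, rfl⟩, fEnc_godel_iff.2 hc⟩
  refine ⟨fun e => ∃ c, FEnc c 1 e ∧ Ref Ax (cons (neg (pF c (cons (V (cNum e) 0) 0))) 0),
    .ex (.and (.fEnc (.var 1) (.const 1) (.var 0)) ((ref_sp hAx).comp ?_)), fun θ => ?_⟩
  · exact .cons (.neg (.pF (.var 1) (.cons (.V (.cNum (.var 0)) (.const 0)) (.const 0)))) (.const 0)
  · constructor
    · rintro ⟨c, hc, hR⟩
      exact (ref_iff_proves hA (fEnc_godel_iff.1 hc) _).1 hR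
    · intro hP
      obtain ⟨c, hc⟩ := exists_fc θ
      exact ⟨c, fEnc_godel_iff.2 hc, (ref_iff_proves hA hc _).2 hP⟩

/-- **Theorem 2.1** (semantic Gödel, generalized).  No sound and
`Σₙ`-definable (`n > 0`) extension of `Q` is `Πₙ`-complete; moreover, any
Gödel-style fixed point `γ` with `Q ⊢ γ ↔ ¬Prov_T(⌜γ⌝)` — where `Prov_T` is a
`Σₙ`-formula defining the set of (Gödel numbers of) theorems of `T` — is a
true `Πₙ`-sentence unprovable in `T`. -/
theorem sound_sigmaDefinable_not_piComplete (n : ℕ) (hn : 0 < n) (T : LA.Theory)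
    (hQ : ExtendsQ T) (hdef : SigmaDefinable n (axiomCodes T)) (hsound : Sound T) :
    (∃ φ : LA.Sentence, IsPi n φ ∧ ℕ ⊨ φ ∧ ¬ Proves T φ) ∧
      ∀ P : LA.BoundedFormula Empty 1, IsSigma n P → Defines P (theoremCodes T) →
        ∀ γ : LA.Sentence, IsPi n γ →
          Proves QTheory (γ ⇔ ∼(subst1 P (godel γ))) →
          ℕ ⊨ γ ∧ ¬ Proves T γ := by
  obtain ⟨n, rfl⟩ := Nat.exists_eq_succ_of_ne_zero hn.ne'
  refine ⟨?_, fun P _ hP γ _ hγ => ?_⟩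
  · by_contra! H
    obtain ⟨D, hD, hDT⟩ := exists_sd_diagonal hdef
    obtain ⟨χ, hχ, eχ⟩ := hD 1 id
    obtain ⟨θ, hθ, eθ⟩ := hχ.defBy.2 1 id
    have h₁ : ℕ ⊨ instNum θ (godel θ) ↔ ¬ D (godel θ) := by
      rw [realize_instNum, iterate_mSucc_nat, eθ]
      exact not_congr (eχ _ _)
    have h₂ : D (godel θ) ↔ ℕ ⊨ instNum θ (godel θ) :=
      (hDT θ).trans ⟨hsound _, fun h => H _ (hθ.instNum _) h⟩
    tauto
  · have hT : Proves T (γ ⇔ ∼(subst1 P (godel γ))) := Theory.models_sentence_iff.2 fun M =>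
      have : M ⊨ QTheory := ⟨fun φ hφ => Theory.models_sentence_iff.1 (hQ φ hφ) M⟩
      Theory.models_sentence_iff.1 hγ (Theory.ModelType.of QTheory M)
    have h₁ : ℕ ⊨ γ ↔ ¬ ℕ ⊨ subst1 P (godel γ) := by
      simpa [Sentence.Realize, Formula.Realize] using hsound _ hT
    have h₂ : ℕ ⊨ subst1 P (godel γ) ↔ Proves T γ := by
      rw [realize_subst1_nat, ← Subsingleton.elim (fun e : Empty => e.elim) default, ← hP]
      constructor
      · rintro ⟨φ, hφ, e⟩
        rwa [← godel_injective e]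
      · exact fun h => ⟨γ, h, rfl⟩
    have h₃ := hsound γ
    tauto

end GRNonRE
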